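/- arXiv:1902.06473 — 3 statements merged into one kernel-verified Lean document; each statement's English description precedes it below -/
import Mathlib

section
/- For every integer k ≥ 1, the number of linear extensions of the poset N_k satisfies binomial(2k, k) ≤ |Δ(N_k)| ≤ binomial(4k, 2k); consequently ln(|Δ(N_k)|) = Θ(k), i.e. there exist constants c1, c2 > 0 with c1·k ≤ ln(|Δ(N_k)|) ≤ c2·k for all k ≥ 1. -/
open MeasureTheory Finset

attribute [local instance] Classical.propDecidable

noncomputable def harm (q : ℕ) : ℝ := ∑ m ∈ Finset.range q, (1 : ℝ) / (m + 1)

noncomputable def linExts (α : Type) [Fintype α] (r : α → α → Prop) :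
    Finset (α ≃ Fin (Fintype.card α)) :=
  Finset.univ.filter fun σ => ∀ i j : α, r i j → σ i ≤ σ j

noncomputable def dN {α : Type} [Fintype α] (r : α → α → Prop)
    (σ : α ≃ Fin (Fintype.card α)) (i : α) : ℕ :=
  if ∀ j : α, r j i → j = i then (σ i : ℕ) + 1
  else sInf {m : ℕ | ∃ j : α, j ≠ i ∧ r j i ∧ m = (σ i : ℕ) - (σ j : ℕ)}

noncomputable def QLB (α : Type) [Fintype α] (r : α → α → Prop) : ℝ :=
  (∑ σ ∈ linExts α r, ∑ i : α, harm (dN r σ i - 1)) / ((linExts α r).card : ℝ)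

def chainPolytope (α : Type) [Fintype α] (r : α → α → Prop) : Set (α → ℝ) :=
  {y | (∀ i, 0 ≤ y i) ∧
    ∀ C : Finset α, (∀ i ∈ C, ∀ j ∈ C, r i j ∨ r j i) → ∑ i ∈ C, y i ≤ 1}

def orderPolytope (α : Type) [Fintype α] (r : α → α → Prop) : Set (α → ℝ) :=
  {y | (∀ i, 0 ≤ y i ∧ y i ≤ 1) ∧ ∀ i j : α, r i j → y i ≤ y j}

noncomputable def transferMap (α : Type) [Fintype α] (r : α → α → Prop)
    (y : α → ℝ) (i : α) : ℝ :=
  if ∀ j : α, r j i → j = i then y i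
  else sInf {t : ℝ | ∃ j : α, j ≠ i ∧ r j i ∧ t = y i - y j}

noncomputable def QH (α : Type) [Fintype α] (r : α → α → Prop) : ℝ :=
  ⨍ z in chainPolytope α r, -(1 / (Fintype.card α : ℝ)) * ∑ i : α, Real.log (z i)

noncomputable def posetEntropy (α : Type) [Fintype α] (r : α → α → Prop) : ℝ :=
  sInf {x : ℝ | ∃ z ∈ chainPolytope α r, (∀ i, 0 < z i) ∧
    x = -(1 / (Fintype.card α : ℝ)) * ∑ i : α, Real.log (z i)}

def seriesComp {α β : Type} (r : α → α → Prop) (s : β → β → Prop) :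
    α ⊕ β → α ⊕ β → Prop
  | Sum.inl x, Sum.inl y => r x y
  | Sum.inr x, Sum.inr y => s x y
  | Sum.inl _, Sum.inr _ => True
  | Sum.inr _, Sum.inl _ => False

def parallelComp {α β : Type} (r : α → α → Prop) (s : β → β → Prop) :
    α ⊕ β → α ⊕ β → Prop
  | Sum.inl x, Sum.inl y => r x y
  | Sum.inr x, Sum.inr y => s x y
  | _, _ => False

/-- Ground set of the poset `N_k`: four copies of `Fin k` (the chains A, B, C, D). -/
abbrev NCarrier (k : ℕ) : Type := Fin k ⊕ Fin k ⊕ Fin k ⊕ Fin k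

/-- The order relation of the poset `N_k`. -/
def NRel (k : ℕ) : NCarrier k → NCarrier k → Prop
  | Sum.inl i, Sum.inl j => i ≤ j
  | Sum.inl _, Sum.inr (Sum.inl _) => True
  | Sum.inr (Sum.inl i), Sum.inr (Sum.inl j) => i ≤ j
  | Sum.inr (Sum.inr (Sum.inl i)), Sum.inr (Sum.inr (Sum.inl j)) => i ≤ j
  | Sum.inr (Sum.inr (Sum.inl _)), Sum.inr (Sum.inl _) => True
  | Sum.inr (Sum.inr (Sum.inl _)), Sum.inr (Sum.inr (Sum.inr _)) => True
  | Sum.inr (Sum.inr (Sum.inr i)), Sum.inr (Sum.inr (Sum.inr j)) => i ≤ j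
  | _, _ => False

theorem mem_linExts {α : Type} [Fintype α] {r : α → α → Prop}
    {σ : α ≃ Fin (Fintype.card α)} :
    σ ∈ linExts α r ↔ ∀ i j : α, r i j → σ i ≤ σ j := by
  simp [linExts]

/-- A linear extension is strictly monotone along a chain embedded in the poset. -/
theorem strictMono_of_mem_linExts {α β : Type} [Fintype α] [LinearOrder β] {r : α → α → Prop}
    {σ : α ≃ Fin (Fintype.card α)} (hσ : σ ∈ linExts α r) {e : β → α}
    (he : Function.Injective e) (hr : ∀ x y, x ≤ y → r (e x) (e y)) :
    StrictMono fun x => σ (e x) := by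
  have hmono : Monotone fun x => σ (e x) := fun x y hxy =>
    mem_linExts.mp hσ _ _ (hr x y hxy)
  exact hmono.strictMono_of_injective (σ.injective.comp he)

/-- The chain `A` followed by `B`. -/
def lowerChain (k : ℕ) (x : Fin k ⊕ₗ Fin k) : NCarrier k :=
  Sum.elim Sum.inl (fun i => Sum.inr (Sum.inl i)) (ofLex x)

/-- The chain `C` followed by `D`. -/
def upperChain (k : ℕ) (x : Fin k ⊕ₗ Fin k) : NCarrier k :=
  Sum.inr (Sum.inr (ofLex x))

theorem lowerChain_injective (k : ℕ) : Function.Injective (lowerChain k) := by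
  refine Function.Injective.comp (g := Sum.elim Sum.inl fun i => Sum.inr (Sum.inl i)) ?_
    ofLex.injective
  exact Sum.inl_injective.sumElim (Sum.inr_injective.comp Sum.inl_injective)
    fun _ _ => Sum.inl_ne_inr

theorem upperChain_injective (k : ℕ) : Function.Injective (upperChain k) := by
  intro x y h
  exact ofLex.injective (Sum.inr_injective (Sum.inr_injective h))

theorem nRel_lowerChain (k : ℕ) (x y : Fin k ⊕ₗ Fin k) (h : x ≤ y) :
    NRel k (lowerChain k x) (lowerChain k y) := by
  rcases x with x | x <;> rcases y with y | y
  · exact Sum.Lex.inl_le_inl_iff.mp h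
  · trivial
  · exact (Sum.Lex.not_inr_le_inl h).elim
  · exact Sum.Lex.inr_le_inr_iff.mp h

theorem nRel_upperChain (k : ℕ) (x y : Fin k ⊕ₗ Fin k) (h : x ≤ y) :
    NRel k (upperChain k x) (upperChain k y) := by
  rcases x with x | x <;> rcases y with y | y
  · exact Sum.Lex.inl_le_inl_iff.mp h
  · trivial
  · exact (Sum.Lex.not_inr_le_inl h).elim
  · exact Sum.Lex.inr_le_inr_iff.mp h

theorem range_upperChain (k : ℕ) : Set.range (upperChain k) = (Set.range (lowerChain k))ᶜ := by
  ext x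
  simp only [Set.mem_range, Set.mem_compl_iff]
  constructor
  · rintro ⟨y, rfl⟩ ⟨z, hz⟩
    rcases z with z | z
    · exact Sum.inl_ne_inr hz
    · exact Sum.inl_ne_inr (Sum.inr_injective hz)
  · intro h
    rcases x with x | x | x
    · exact (h ⟨toLex (Sum.inl x), rfl⟩).elim
    · exact (h ⟨toLex (Sum.inr x), rfl⟩).elim
    · exact ⟨toLex x, rfl⟩

theorem card_nCarrier (k : ℕ) : Fintype.card (NCarrier k) = 4 * k := by
  simp only [Fintype.card_sum, Fintype.card_fin]
  omega

/-- A linear extension of `N_k` is determined by the positions occupied by `A ∪ B`. -/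
theorem card_linExts_nRel_le (k : ℕ) :
    (linExts (NCarrier k) (NRel k)).card ≤ Nat.choose (4 * k) (2 * k) := by
  let F : (NCarrier k ≃ Fin (Fintype.card (NCarrier k))) →
      Finset (Fin (Fintype.card (NCarrier k))) :=
    fun σ => Finset.univ.image fun x => σ (lowerChain k x)
  have hcard : (Finset.powersetCard (2 * k)
      (Finset.univ : Finset (Fin (Fintype.card (NCarrier k))))).card =
      Nat.choose (4 * k) (2 * k) := by
    rw [Finset.card_powersetCard, Finset.card_univ, Fintype.card_fin, card_nCarrier]
  rw [← hcard]
  refine Finset.card_le_card_of_injOn F (fun σ _ => ?_) ?_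
  · refine Finset.mem_coe.mpr (Finset.mem_powersetCard.mpr ⟨Finset.subset_univ _, ?_⟩)
    change (Finset.univ.image (σ ∘ lowerChain k)).card = 2 * k
    rw [Finset.card_image_of_injective _ (σ.injective.comp (lowerChain_injective k)),
      Finset.card_univ, Fintype.card_lex, Fintype.card_sum, Fintype.card_fin, two_mul]
  · intro σ hσ τ hτ h
    have hlow : (Set.range fun x => σ (lowerChain k x)) =
        Set.range fun x => τ (lowerChain k x) := by
      have hcoe := Finset.coe_inj.mpr h
      simpa only [F, Finset.coe_image, Finset.coe_univ, Set.image_univ] using hcoe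
    have hup : (Set.range fun x => σ (upperChain k x)) =
        Set.range fun x => τ (upperChain k x) := by
      have hcompl (ρ : NCarrier k ≃ Fin (Fintype.card (NCarrier k))) :
          (Set.range fun x => ρ (upperChain k x)) =
            (Set.range fun x => ρ (lowerChain k x))ᶜ := by
        change Set.range (ρ ∘ upperChain k) = (Set.range (ρ ∘ lowerChain k))ᶜ
        rw [Set.range_comp, Set.range_comp, range_upperChain, Set.image_compl_eq ρ.bijective]
      rw [hcompl, hcompl, hlow]
    have elow := ((strictMono_of_mem_linExts hσ (lowerChain_injective k)
      (nRel_lowerChain k)).range_inj (strictMono_of_mem_linExts hτ (lowerChain_injective k)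
      (nRel_lowerChain k))).mp hlow
    have eup := ((strictMono_of_mem_linExts hσ (upperChain_injective k)
      (nRel_upperChain k)).range_inj (strictMono_of_mem_linExts hτ (upperChain_injective k)
      (nRel_upperChain k))).mp hup
    ext1 x
    rcases x with x | x | x
    · exact congrFun elow (toLex (Sum.inl x))
    · exact congrFun elow (toLex (Sum.inr x))
    · exact congrFun eup (toLex x)

/-- The positions in which `A` occupies `T`, `C` occupies the complement of `T` in the first
`2 * k` places, and `B` and then `D` follow. -/
def shufflePosition (k : ℕ) (T : Finset (Fin (2 * k))) (hT : T.card = k) (hT' : Tᶜ.card = k) :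
    NCarrier k → Fin (Fintype.card (NCarrier k))
  | Sum.inl i => Fin.castLE (by rw [card_nCarrier]; omega) (T.orderEmbOfFin hT i)
  | Sum.inr (Sum.inl i) => ⟨2 * k + i, by rw [card_nCarrier]; omega⟩
  | Sum.inr (Sum.inr (Sum.inl i)) =>
      Fin.castLE (by rw [card_nCarrier]; omega) (Tᶜ.orderEmbOfFin hT' i)
  | Sum.inr (Sum.inr (Sum.inr i)) => ⟨3 * k + i, by rw [card_nCarrier]; omega⟩

theorem shufflePosition_injective (k : ℕ) (T : Finset (Fin (2 * k))) (hT : T.card = k)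
    (hT' : Tᶜ.card = k) : Function.Injective (shufflePosition k T hT hT') := by
  have hne (i j : Fin k) : (T.orderEmbOfFin hT i : ℕ) ≠ Tᶜ.orderEmbOfFin hT' j := by
    intro h
    have hi := T.orderEmbOfFin_mem hT i
    rw [Fin.ext h] at hi
    exact Finset.mem_compl.mp (Tᶜ.orderEmbOfFin_mem hT' j) hi
  have hA (i j : Fin k) (h : (T.orderEmbOfFin hT i : ℕ) = T.orderEmbOfFin hT j) : i = j :=
    (T.orderEmbOfFin hT).injective (Fin.ext h)
  have hC (i j : Fin k) (h : (Tᶜ.orderEmbOfFin hT' i : ℕ) = Tᶜ.orderEmbOfFin hT' j) : i = j :=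
    (Tᶜ.orderEmbOfFin hT').injective (Fin.ext h)
  rintro (i | i | i | i) (j | j | j | j) h <;>
    simp only [shufflePosition, Fin.ext_iff, Fin.val_castLE] at h
  all_goals grind

theorem shufflePosition_mono (k : ℕ) (T : Finset (Fin (2 * k))) (hT : T.card = k)
    (hT' : Tᶜ.card = k) (x y : NCarrier k) (h : NRel k x y) :
    shufflePosition k T hT hT' x ≤ shufflePosition k T hT hT' y := by
  rcases x with i | i | i | i <;> rcases y with j | j | j | j <;>
    simp only [NRel] at h <;>
    simp only [shufflePosition, Fin.le_def, Fin.val_castLE]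
  case inl.inl => exact (T.orderEmbOfFin hT).monotone h
  case inr.inr.inl.inr.inr.inl => exact (Tᶜ.orderEmbOfFin hT').monotone h
  all_goals omega

theorem le_card_linExts_nRel (k : ℕ) :
    Nat.choose (2 * k) k ≤ (linExts (NCarrier k) (NRel k)).card := by
  have hcompl {T : Finset (Fin (2 * k))} (hT : T.card = k) : Tᶜ.card = k := by
    rw [Finset.card_compl, Fintype.card_fin, hT]
    omega
  let G : {T : Finset (Fin (2 * k)) // T.card = k} →
      (NCarrier k ≃ Fin (Fintype.card (NCarrier k))) := fun T =>
    Equiv.ofBijective (shufflePosition k T.1 T.2 (hcompl T.2))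
      ((Fintype.bijective_iff_injective_and_card _).mpr
        ⟨shufflePosition_injective k T.1 T.2 (hcompl T.2), (Fintype.card_fin _).symm⟩)
  have hcard : (Finset.univ : Finset {T : Finset (Fin (2 * k)) // T.card = k}).card =
      Nat.choose (2 * k) k := by
    rw [Finset.card_univ, Fintype.card_finset_len, Fintype.card_fin]
  rw [← hcard]
  refine Finset.card_le_card_of_injOn G (fun T _ => ?_) ?_
  · exact Finset.mem_coe.mpr (mem_linExts.mpr (shufflePosition_mono k T.1 T.2 (hcompl T.2)))
  · intro T _ U _ h
    have hemb : ⇑(T.val.orderEmbOfFin T.property) = U.val.orderEmbOfFin U.property := by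
      funext i
      have hi := congrArg Fin.val (Equiv.congr_fun h (Sum.inl i))
      exact Fin.ext hi
    have hrange := congrArg Set.range hemb
    rw [Finset.range_orderEmbOfFin, Finset.range_orderEmbOfFin] at hrange
    exact Subtype.ext (Finset.coe_injective hrange)

theorem two_pow_le_centralBinom (k : ℕ) : 2 ^ k ≤ Nat.centralBinom k := by
  induction k with
  | zero => simp
  | succ n ih =>
    have h := Nat.succ_mul_centralBinom_succ n
    refine Nat.le_of_mul_le_mul_left ?_ n.succ_pos
    rw [Nat.succ_eq_add_one, h, pow_succ]
    nlinarith

/-- `binom(2k,k) ≤ |Δ(N_k)| ≤ binom(4k,2k)`, and consequently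
`ln |Δ(N_k)| = Θ(k)`. -/
theorem stmt_13 :
    (∀ k : ℕ, 1 ≤ k →
      Nat.choose (2 * k) k ≤ (linExts (NCarrier k) (NRel k)).card ∧
      (linExts (NCarrier k) (NRel k)).card ≤ Nat.choose (4 * k) (2 * k)) ∧
    ∃ c1 c2 : ℝ, 0 < c1 ∧ 0 < c2 ∧ ∀ k : ℕ, 1 ≤ k →
      c1 * (k : ℝ) ≤ Real.log ((linExts (NCarrier k) (NRel k)).card) ∧
      Real.log ((linExts (NCarrier k) (NRel k)).card) ≤ c2 * (k : ℝ) := by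
  refine ⟨fun k _ => ⟨le_card_linExts_nRel k, card_linExts_nRel_le k⟩,
    Real.log 2, 4 * Real.log 2, Real.log_pos one_lt_two,
    mul_pos four_pos (Real.log_pos one_lt_two), fun k _ => ?_⟩
  have hlow : 2 ^ k ≤ (linExts (NCarrier k) (NRel k)).card :=
    (two_pow_le_centralBinom k).trans (le_card_linExts_nRel k)
  have hup : (linExts (NCarrier k) (NRel k)).card ≤ 2 ^ (4 * k) :=
    (card_linExts_nRel_le k).trans (Nat.choose_le_two_pow _ _)
  have hlow' : (2 : ℝ) ^ k ≤ (linExts (NCarrier k) (NRel k)).card := by exact_mod_cast hlow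
  have hup' : ((linExts (NCarrier k) (NRel k)).card : ℝ) ≤ 2 ^ (4 * k) := by exact_mod_cast hup
  have hpos : (0 : ℝ) < 2 ^ k := by positivity
  constructor
  · have h := Real.log_le_log hpos hlow'
    rw [Real.log_pow] at h
    linarith
  · have h := Real.log_le_log (hpos.trans_le hlow') hup'
    rw [Real.log_pow] at h
    push_cast at h
    linarith
end

section
/- There exists a universal constant c > 0 such that for every extended series-parallel poset P, QLB(P) ≥ c · ln(|Δ(P)|). -/
open MeasureTheory Finset

attribute [local instance] Classical.propDecidable

inductive ESPTree : Type
  | leaf : ESPTree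
  | nk : (k : ℕ) → 1 ≤ k → ESPTree
  | series : ESPTree → ESPTree → ESPTree
  | parallel : ESPTree → ESPTree → ESPTree

def ESPTree.carrier : ESPTree → Type
  | .leaf => Unit
  | .nk k _ => NCarrier k
  | .series l r => l.carrier ⊕ r.carrier
  | .parallel l r => l.carrier ⊕ r.carrier

def ESPTree.rel : (t : ESPTree) → t.carrier → t.carrier → Prop
  | .leaf => fun _ _ => True
  | .nk k _ => NRel k
  | .series l r => seriesComp l.rel r.rel
  | .parallel l r => parallelComp l.rel r.rel

/-- `r` is (order-isomorphic to) an extended series-parallel poset. -/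
def IsExtendedSeriesParallel (α : Type) (r : α → α → Prop) : Prop :=
  ∃ (t : ESPTree) (e : α ≃ t.carrier), ∀ x y : α, r x y ↔ t.rel (e x) (e y)

theorem harm_succ (n : ℕ) : harm (n + 1) = harm n + 1 / ((n : ℝ) + 1) := by
  simp [harm, Finset.sum_range_succ]

theorem harm_nonneg (n : ℕ) : 0 ≤ harm n :=
  Finset.sum_nonneg fun m _ => by positivity

theorem one_le_harm {n : ℕ} (hn : 1 ≤ n) : 1 ≤ harm n := by
  obtain ⟨m, rfl⟩ := Nat.exists_eq_add_of_le' hn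
  induction m with
  | zero => simp [harm]
  | succ m ih =>
    have h := harm_succ (m + 1)
    have : (0 : ℝ) ≤ 1 / (((m + 1 : ℕ) : ℝ) + 1) := by positivity
    linarith [ih (by omega)]

section Positions

variable {α β : Type} [Fintype α] [Fintype β]

/-- One plus the largest position of a strict predecessor of `i`, or `0` if `i` is minimal. -/
noncomputable def lastPred (r : α → α → Prop) (pos : α → ℕ) (i : α) : ℕ :=
  (Finset.univ.filter fun j => j ≠ i ∧ r j i).sup fun j => pos j + 1

/-- The distance from `i` back to its nearest predecessor. -/
noncomputable def gap (r : α → α → Prop) (pos : α → ℕ) (i : α) : ℕ :=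
  pos i + 1 - lastPred r pos i

/-- The sum of harmonic numbers whose average over linear extensions is `QLB`. -/
noncomputable def cost (r : α → α → Prop) (pos : α → ℕ) : ℝ :=
  ∑ i, harm (gap r pos i - 1)

theorem lastPred_le_iff {r : α → α → Prop} {pos : α → ℕ} {i : α} {m : ℕ} :
    lastPred r pos i ≤ m ↔ ∀ j, j ≠ i → r j i → pos j + 1 ≤ m := by
  simp [lastPred, Finset.sup_le_iff]

theorem le_lastPred {r : α → α → Prop} {pos : α → ℕ} {i j : α} (hj : j ≠ i) (h : r j i) :
    pos j + 1 ≤ lastPred r pos i :=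
  lastPred_le_iff.1 le_rfl j hj h

theorem lastPred_eq_zero_or (r : α → α → Prop) (pos : α → ℕ) (i : α) :
    ((∀ j, r j i → j = i) ∧ lastPred r pos i = 0) ∨
      ∃ j, j ≠ i ∧ r j i ∧ lastPred r pos i = pos j + 1 := by
  by_cases h : ∀ j, r j i → j = i
  · refine Or.inl ⟨h, Nat.le_zero.1 (lastPred_le_iff.2 fun j hj hr => absurd (h j hr) hj)⟩
  · push Not at h
    obtain ⟨j, hr, hj⟩ := h
    obtain ⟨a, ha, hs⟩ := Finset.exists_mem_eq_sup
      (Finset.univ.filter fun j => j ≠ i ∧ r j i) ⟨j, by simp [hj, hr]⟩ (fun j => pos j + 1)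
    simp only [Finset.mem_filter, Finset.mem_univ, true_and] at ha
    exact Or.inr ⟨a, ha.1, ha.2, hs⟩

theorem dN_eq_gap (r : α → α → Prop) (σ : α ≃ Fin (Fintype.card α)) (i : α) :
    dN r σ i = gap r (fun j => (σ j : ℕ)) i := by
  unfold dN gap
  rcases lastPred_eq_zero_or r (fun j => (σ j : ℕ)) i with ⟨h, h0⟩ | ⟨j, hj, hr, hs⟩
  · rw [if_pos h, h0, Nat.sub_zero]
  · rw [if_neg fun h => hj (h j hr), hs]
    apply le_antisymm
    · exact Nat.sInf_le ⟨j, hj, hr, (Nat.add_sub_add_right _ 1 _)⟩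
    · refine le_csInf ⟨_, j, hj, hr, rfl⟩ ?_
      rintro m ⟨a, ha, hra, rfl⟩
      have h := le_lastPred (pos := fun j => (σ j : ℕ)) ha hra
      dsimp only at h hs ⊢
      omega

/-- The linear extensions of `r`, as bijections onto `Fin n`. -/
noncomputable def lext (n : ℕ) (r : α → α → Prop) : Finset (α ≃ Fin n) :=
  Finset.univ.filter fun σ => ∀ i j : α, r i j → σ i ≤ σ j

/-- The sum of `cost` over all linear extensions. -/
noncomputable def totalCost (n : ℕ) (r : α → α → Prop) : ℝ :=
  ∑ σ ∈ lext n r, cost r fun i => (σ i : ℕ)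

theorem mem_lext {n : ℕ} {r : α → α → Prop} {σ : α ≃ Fin n} :
    σ ∈ lext n r ↔ ∀ i j : α, r i j → σ i ≤ σ j := by
  simp [lext]

theorem linExts_eq_lext (r : α → α → Prop) : linExts α r = lext (Fintype.card α) r := rfl

theorem QLB_eq (r : α → α → Prop) :
    QLB α r = totalCost (Fintype.card α) r / ((lext (Fintype.card α) r).card : ℝ) := by
  simp only [QLB, totalCost, cost, dN_eq_gap, linExts_eq_lext]

theorem lastPred_le_of_mem {n : ℕ} {r : α → α → Prop} {σ : α ≃ Fin n} (hσ : σ ∈ lext n r)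
    (i : α) : lastPred r (fun j => (σ j : ℕ)) i ≤ σ i := by
  refine lastPred_le_iff.2 fun j hj hr => ?_
  have h1 := mem_lext.1 hσ j i hr
  have h2 : σ j ≠ σ i := fun h => hj (σ.injective h)
  exact lt_of_le_of_ne h1 h2

theorem cost_nonneg (r : α → α → Prop) (pos : α → ℕ) : 0 ≤ cost r pos :=
  Finset.sum_nonneg fun _ _ => harm_nonneg _

/-! ### Isomorphisms -/

theorem cost_iso {r : α → α → Prop} {s : β → β → Prop} (e : α ≃ β)
    (h : ∀ x y, r x y ↔ s (e x) (e y)) (pos : β → ℕ) :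
    cost r (fun i => pos (e i)) = cost s pos := by
  refine Fintype.sum_equiv e _ _ fun i => ?_
  have : lastPred r (fun i => pos (e i)) i = lastPred s pos (e i) := by
    apply le_antisymm
    · exact lastPred_le_iff.2 fun j hj hr =>
        le_lastPred (pos := pos) (fun h => hj (e.injective h)) ((h j i).1 hr)
    · refine lastPred_le_iff.2 fun j hj hr => ?_
      have := le_lastPred (r := r) (pos := fun i => pos (e i)) (i := i) (j := e.symm j)
        (fun h => hj (by simp [← h])) ((h _ _).2 (by simpa using hr))
      simpa using this
  simp only [gap, this]

theorem sum_lext_iso {r : α → α → Prop} {s : β → β → Prop} (e : α ≃ β)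
    (h : ∀ x y, r x y ↔ s (e x) (e y)) (n : ℕ) (G : (α → ℕ) → ℝ) :
    ∑ σ ∈ lext n r, G (fun i => σ i) = ∑ σ ∈ lext n s, G (fun i => σ (e i)) := by
  refine Finset.sum_equiv (Equiv.equivCongr e (Equiv.refl _)) (fun σ => ?_) (fun σ _ => ?_)
  · rw [mem_lext, mem_lext]
    refine ⟨fun hσ i j hij => ?_, fun hσ i j hij => ?_⟩
    · simpa using hσ (e.symm i) (e.symm j) ((h _ _).2 (by simpa using hij))
    · simpa using hσ (e i) (e j) ((h _ _).1 hij)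
  · simp

theorem card_lext_iso {r : α → α → Prop} {s : β → β → Prop} (e : α ≃ β)
    (h : ∀ x y, r x y ↔ s (e x) (e y)) (n : ℕ) : (lext n r).card = (lext n s).card := by
  have := sum_lext_iso e h n fun _ => 1
  simpa using this

theorem totalCost_iso {r : α → α → Prop} {s : β → β → Prop} (e : α ≃ β)
    (h : ∀ x y, r x y ↔ s (e x) (e y)) (n : ℕ) : totalCost n r = totalCost n s := by
  rw [totalCost, sum_lext_iso e h n (cost r)]
  exact Finset.sum_congr rfl fun σ _ => cost_iso e h fun i => (σ i : ℕ)

/-! ### Series composition -/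

theorem lastPred_inl {r : α → α → Prop} {t : α ⊕ β → α ⊕ β → Prop} {pos : α ⊕ β → ℕ}
    (h : ∀ x y, t (Sum.inl x) (Sum.inl y) ↔ r x y) (h' : ∀ x y, ¬ t (Sum.inr x) (Sum.inl y))
    (i : α) : lastPred t pos (Sum.inl i) = lastPred r (fun x => pos (Sum.inl x)) i := by
  apply le_antisymm
  · refine lastPred_le_iff.2 ?_
    rintro (j | j) hj hr
    · exact le_lastPred (pos := fun x => pos (Sum.inl x)) (fun h => hj (h ▸ rfl)) ((h j i).1 hr)
    · exact absurd hr (h' j i)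
  · exact lastPred_le_iff.2 fun j hj hr =>
      le_lastPred (pos := pos) (fun h => hj (Sum.inl_injective h)) ((h j i).2 hr)

theorem lastPred_inr {s : β → β → Prop} {t : α ⊕ β → α ⊕ β → Prop} {pos : α ⊕ β → ℕ}
    (h : ∀ x y, t (Sum.inr x) (Sum.inr y) ↔ s x y) (h' : ∀ x y, ¬ t (Sum.inl x) (Sum.inr y))
    (j : β) : lastPred t pos (Sum.inr j) = lastPred s (fun x => pos (Sum.inr x)) j := by
  apply le_antisymm
  · refine lastPred_le_iff.2 ?_
    rintro (i | i) hi hr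
    · exact absurd hr (h' i j)
    · exact le_lastPred (pos := fun x => pos (Sum.inr x)) (fun h => hi (h ▸ rfl)) ((h i j).1 hr)
  · exact lastPred_le_iff.2 fun i hi hr =>
      le_lastPred (pos := pos) (fun h => hi (Sum.inr_injective h)) ((h i j).2 hr)

theorem cost_series {p : ℕ} (r : α → α → Prop) (s : β → β → Prop) {pos : α ⊕ β → ℕ}
    {a : α → ℕ} {b : β → ℕ} (ha : ∀ i, pos (Sum.inl i) = a i)
    (hb : ∀ j, pos (Sum.inr j) = p + b j) (hlt : ∀ i, a i < p)
    (hp : p = 0 ∨ ∃ i, a i + 1 = p) :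
    cost (seriesComp r s) pos = cost r a + cost s b := by
  unfold cost
  rw [Fintype.sum_sum_type]
  congr 1 <;> refine Finset.sum_congr rfl fun i _ => ?_
  · simp only [gap]
    rw [lastPred_inl (r := r) (by simp [seriesComp]) (by simp [seriesComp])]
    simp only [ha]
  · have : lastPred (seriesComp r s) pos (Sum.inr i) = p + lastPred s b i := by
      apply le_antisymm
      · refine lastPred_le_iff.2 ?_
        rintro (j | j) hj hr
        · have := hlt j
          have := ha j
          omega
        · have := le_lastPred (pos := b) (fun h => hj (congrArg Sum.inr h)) (show s j i from hr)
          have := hb j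
          omega
      · rcases lastPred_eq_zero_or s b i with ⟨_, h0⟩ | ⟨j, hj, hr, h0⟩
        · rcases hp with hp | ⟨j, hj⟩
          · omega
          · have := le_lastPred (r := seriesComp r s) (pos := pos) (i := Sum.inr i)
              (j := Sum.inl j) (by simp) trivial
            have := ha j
            omega
        · have := le_lastPred (r := seriesComp r s) (pos := pos) (i := Sum.inr i)
            (j := Sum.inr j) (by simpa using hj) hr
          have := hb j
          omega
    simp only [gap, this, hb]
    congr 1
    omega

theorem sum_lext_series {p q : ℕ} (hp : Fintype.card α = p) (hq : Fintype.card β = q)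
    (r : α → α → Prop) (s : β → β → Prop) (G : (α ⊕ β ≃ Fin (p + q)) → ℝ) :
    ∑ σ ∈ lext (p + q) (seriesComp r s), G σ =
      ∑ τ ∈ lext p r, ∑ ρ ∈ lext q s, G ((τ.sumCongr ρ).trans finSumFinEquiv) := by
  rw [← Finset.sum_product']
  symm
  refine Finset.sum_bij (fun x _ => (x.1.sumCongr x.2).trans finSumFinEquiv) ?_ ?_ ?_
    (fun _ _ => rfl)
  · rintro ⟨τ, ρ⟩ hx
    simp only [Finset.mem_product, mem_lext] at hx ⊢
    rintro (i | i) (j | j) hij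
    · exact Fin.le_def.2 (by simpa using hx.1 i j hij)
    · simp [Fin.le_def]
      omega
    · exact hij.elim
    · simpa using hx.2 i j hij
  · rintro ⟨τ, ρ⟩ _ ⟨τ', ρ'⟩ _ h
    have h1 : ∀ x, τ.sumCongr ρ x = τ'.sumCongr ρ' x := fun x => by
      simpa using DFunLike.congr_fun h x
    ext i
    · simpa [Fin.ext_iff] using h1 (Sum.inl i)
    · simpa [Fin.ext_iff] using h1 (Sum.inr i)
  · intro σ hσ
    rw [mem_lext] at hσ
    have hlt : ∀ i j, σ (Sum.inl i) < σ (Sum.inr j) := fun i j =>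
      lt_of_le_of_ne (hσ _ _ trivial) fun h => by simpa using σ.injective h
    have hl : ∀ i, (σ (Sum.inl i) : ℕ) < p := by
      intro i
      have hsub : Finset.Iic (σ (Sum.inl i)) ⊆ Finset.univ.image fun a : α => σ (Sum.inl a) := by
        intro t ht
        rcases hx : σ.symm t with a | b
        · exact Finset.mem_image.2 ⟨a, Finset.mem_univ _, by simp [← hx]⟩
        · have := hlt i b
          rw [← hx, Equiv.apply_symm_apply] at this
          exact absurd (Finset.mem_Iic.1 ht) (not_le.2 this)
      have := (Finset.card_le_card hsub).trans Finset.card_image_le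
      rw [Fin.card_Iic, Finset.card_univ, hp] at this
      omega
    have hr : ∀ j, p ≤ (σ (Sum.inr j) : ℕ) := by
      intro j
      have hsub : (Finset.univ.image fun a : α => σ (Sum.inl a)) ⊆ Finset.Iio (σ (Sum.inr j)) := by
        intro t ht
        obtain ⟨a, _, rfl⟩ := Finset.mem_image.1 ht
        exact Finset.mem_Iio.2 (hlt a j)
      have := Finset.card_le_card hsub
      rw [Finset.card_image_of_injective _ fun a b h => Sum.inl_injective (σ.injective h),
        Fin.card_Iio, Finset.card_univ, hp] at this
      exact this
    have hτ : Function.Bijective fun i => (⟨σ (Sum.inl i), hl i⟩ : Fin p) :=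
      (Fintype.bijective_iff_injective_and_card _).2
        ⟨fun a b h => by simpa [Fin.val_inj] using h, by simp [hp]⟩
    have hρ : Function.Bijective fun j =>
        (⟨σ (Sum.inr j) - p, by have := hr j; have := (σ (Sum.inr j)).2; omega⟩ : Fin q) :=
      (Fintype.bijective_iff_injective_and_card _).2
        ⟨fun a b h => by
          have h1 := hr a
          have h2 := hr b
          simp only [Fin.mk.injEq] at h
          have : σ (Sum.inr a) = σ (Sum.inr b) := Fin.ext (by omega)
          simpa using this, by simp [hq]⟩
    refine ⟨(Equiv.ofBijective _ hτ, Equiv.ofBijective _ hρ), ?_, ?_⟩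
    · simp only [Finset.mem_product, mem_lext]
      refine ⟨fun i j hij => hσ _ _ (show seriesComp r s (Sum.inl i) (Sum.inl j) from hij),
        fun i j hij => ?_⟩
      have := hσ (Sum.inr i) (Sum.inr j) hij
      simp only [Equiv.ofBijective_apply, Fin.le_def] at this ⊢
      omega
    · ext x
      rcases x with i | j
      · simp
      · have := hr j
        simp
        omega

theorem card_lext_series {p q : ℕ} (hp : Fintype.card α = p) (hq : Fintype.card β = q)
    (r : α → α → Prop) (s : β → β → Prop) :
    (lext (p + q) (seriesComp r s)).card = (lext p r).card * (lext q s).card := by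
  have := sum_lext_series hp hq r s fun _ => 1
  simp only [Finset.sum_const, nsmul_eq_mul, mul_one] at this
  exact_mod_cast this

theorem totalCost_series {p q : ℕ} (hp : Fintype.card α = p) (hq : Fintype.card β = q)
    (r : α → α → Prop) (s : β → β → Prop) :
    totalCost (p + q) (seriesComp r s) =
      (lext q s).card * totalCost p r + (lext p r).card * totalCost q s := by
  rw [totalCost, sum_lext_series hp hq r s fun σ => cost _ fun x => (σ x : ℕ)]
  have h (τ : α ≃ Fin p) (ρ : β ≃ Fin q) :
      cost (seriesComp r s) (fun x => ((τ.sumCongr ρ).trans finSumFinEquiv x : ℕ)) =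
        cost r (fun i => (τ i : ℕ)) + cost s (fun j => (ρ j : ℕ)) := by
    refine cost_series (p := p) r s (by simp) (by simp) (fun i => (τ i).2) ?_
    rcases Nat.eq_zero_or_pos p with h | h
    · exact Or.inl h
    · refine Or.inr ⟨τ.symm ⟨p - 1, by omega⟩, ?_⟩
      simp
      omega
  simp only [h, Finset.sum_add_distrib, Finset.sum_const, nsmul_eq_mul, totalCost,
    ← Finset.mul_sum]

end Positions
/-! ### Shuffles -/

/-- The increasing maps `Fin p → Fin n`: the possible positions of one factor in a shuffle. -/
noncomputable def shuffles (p n : ℕ) : Finset (Fin p → Fin n) :=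
  Finset.univ.filter StrictMono

theorem mem_shuffles {p n : ℕ} {f : Fin p → Fin n} : f ∈ shuffles p n ↔ StrictMono f := by
  simp [shuffles]

/-- The `m`-th position occupied by a shuffle, counted from one, with value `0` at `0`. -/
noncomputable def place {p n : ℕ} (f : Fin p → Fin n) (m : ℕ) : ℕ :=
  (Finset.univ.filter fun j : Fin p => (j : ℕ) < m).sup fun j => (f j : ℕ) + 1

theorem place_mono {p n : ℕ} (f : Fin p → Fin n) : Monotone (place f) := by
  intro a b hab
  exact Finset.sup_mono fun j hj => by
    simp only [Finset.mem_filter, Finset.mem_univ, true_and] at hj ⊢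
    omega

theorem place_zero {p n : ℕ} (f : Fin p → Fin n) : place f 0 = 0 := by
  simp [place]

theorem place_succ {p n : ℕ} {f : Fin p → Fin n} (hf : StrictMono f) (j : Fin p) :
    place f (j + 1) = f j + 1 := by
  apply le_antisymm
  · refine Finset.sup_le fun i hi => ?_
    simp only [Finset.mem_filter, Finset.mem_univ, true_and] at hi
    have : f i ≤ f j := hf.monotone (Fin.le_def.2 (by omega))
    exact Nat.succ_le_succ this
  · exact Finset.le_sup (f := fun j => (f j : ℕ) + 1) (by simp)

theorem place_le {p n : ℕ} (f : Fin p → Fin n) (m : ℕ) : place f m ≤ n :=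
  Finset.sup_le fun i _ => (f i).2

theorem place_lt {p n : ℕ} {f : Fin p → Fin n} (hf : StrictMono f) {a b : ℕ} (hab : a < b)
    (hb : b ≤ p) : place f a < place f b := by
  obtain ⟨b, rfl⟩ := Nat.exists_eq_add_of_lt (Nat.zero_lt_of_lt hab)
  simp only [zero_add] at *
  rw [place_succ hf ⟨b, by omega⟩, Nat.lt_succ_iff]
  rcases a with _ | a
  · simp [place_zero]
  · rw [place_succ hf ⟨a, by omega⟩]
    exact hf (Fin.lt_def.2 (by simpa using hab))

theorem place_succAbove {p n : ℕ} {f : Fin p → Fin n} (hf : StrictMono f) (k : Fin (n + 1))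
    {m : ℕ} (hm : m ≤ p) :
    place (fun j => k.succAbove (f j)) m =
      if place f m ≤ k then place f m else place f m + 1 := by
  rcases m with _ | m
  · simp [place_zero]
  · rw [place_succ hf ⟨m, hm⟩,
      place_succ (f := fun j => k.succAbove (f j)) (fun a b h => by simpa using hf h) ⟨m, hm⟩]
    simp only [Fin.succAbove, Fin.lt_def]
    split_ifs <;> simp only [Fin.val_castSucc, Fin.val_succ] at * <;> omega

theorem sum_shuffles_succ {p n : ℕ} (F : (Fin p → Fin (n + 1)) → ℝ) :
    ∑ f ∈ shuffles p n, ∑ k : Fin (n + 1), F (fun j => k.succAbove (f j)) =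
      ((n : ℝ) + 1 - p) * ∑ f ∈ shuffles p (n + 1), F f := by
  have h (k : Fin (n + 1)) : ∑ f ∈ shuffles p n, F (fun j => k.succAbove (f j)) =
      ∑ f ∈ shuffles p (n + 1), if k ∈ Finset.univ.image f then 0 else F f := by
    have h2 (f : Fin p → Fin (n + 1)) : (if k ∈ Finset.univ.image f then 0 else F f) =
      if k ∉ Finset.univ.image f then F f else 0 := by split_ifs <;> rfl
    simp only [h2]
    rw [← Finset.sum_filter]
    refine Finset.sum_bij (fun f _ j => k.succAbove (f j)) ?_ ?_ ?_ (fun _ _ => rfl)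
    · intro f hf
      rw [mem_shuffles] at hf
      simp only [Finset.mem_filter, mem_shuffles, Finset.mem_image, Finset.mem_univ, true_and]
      exact ⟨fun a b h => by simpa using hf h, fun ⟨j, hj⟩ => Fin.succAbove_ne _ _ hj⟩
    · intro f _ g _ h
      funext j
      simpa using congrFun h j
    · intro f hf
      simp only [Finset.mem_filter, mem_shuffles, Finset.mem_image, Finset.mem_univ, true_and,
        not_exists] at hf
      choose g hg using fun j => Fin.exists_succAbove_eq (hf.2 j)
      refine ⟨g, mem_shuffles.2 fun a b hab => ?_, funext hg⟩
      have := hf.1 hab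
      rw [← hg, ← hg] at this
      simpa using this
  rw [Finset.sum_comm, Finset.sum_congr rfl fun k _ => h k, Finset.sum_comm, Finset.mul_sum]
  refine Finset.sum_congr rfl fun f hf => ?_
  have hc : (Finset.univ.image f).card = p := by
    rw [Finset.card_image_of_injective _ (mem_shuffles.1 hf).injective]
    simp
  have hle : p ≤ n + 1 := by
    have := Finset.card_le_univ (Finset.univ.image f)
    rwa [hc, Fintype.card_fin] at this
  rw [Finset.sum_ite, Finset.sum_const_zero, zero_add, Finset.sum_const, nsmul_eq_mul]
  congr 1
  rw [Finset.filter_not, Finset.filter_mem_eq_inter, Finset.univ_inter,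
    Finset.card_sdiff_of_subset (Finset.subset_univ _), hc, Finset.card_univ, Fintype.card_fin,
    Nat.cast_sub hle]
  push_cast
  ring

theorem shuffles_self (p : ℕ) : shuffles p p = {id} := by
  ext f
  rw [mem_shuffles, Finset.mem_singleton]
  refine ⟨fun h => ?_, fun h => h ▸ strictMono_id⟩
  refine (h.range_inj strictMono_id).1 ?_
  rw [Set.range_id, Set.range_eq_univ]
  exact Finite.injective_iff_surjective.1 h.injective

theorem card_shuffles_succ (p q : ℕ) :
    ((p : ℝ) + q + 1) * (shuffles p (p + q)).card =
      ((q : ℝ) + 1) * (shuffles p (p + (q + 1))).card := by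
  have := sum_shuffles_succ (p := p) (n := p + q) fun _ => 1
  simp only [Finset.sum_const, Finset.card_univ, Fintype.card_fin, nsmul_eq_mul, mul_one] at this
  push_cast at this
  rw [← add_assoc]
  linarith

theorem sum_harm_insert {n A B : ℕ} (hAB : A < B) (hB : B ≤ n) :
    ∑ k : Fin (n + 1), harm ((if B ≤ k then B else B + 1) - (if A ≤ k then A else A + 1) - 1) =
      ((n : ℝ) + 1) * harm (B - A - 1) + 1 := by
  have h (k : Fin (n + 1)) :
      harm ((if B ≤ k then B else B + 1) - (if A ≤ k then A else A + 1) - 1) =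
        harm (B - A - 1) + if (k : ℕ) ∈ Finset.Ico A B then 1 / ((B : ℝ) - A) else 0 := by
    obtain ⟨d, rfl⟩ := Nat.exists_eq_add_of_lt hAB
    simp only [Finset.mem_Ico]
    by_cases h1 : A ≤ k <;> by_cases h2 : A + d + 1 ≤ k
    · rw [if_pos h1, if_pos h2, if_neg (by omega), add_zero]
    · rw [if_pos h1, if_neg h2, if_pos (by omega),
        show A + d + 1 + 1 - A - 1 = d + 1 by omega, harm_succ,
        show A + d + 1 - A - 1 = d by omega]
      push_cast
      ring
    · omega
    · rw [if_neg h1, if_neg h2, if_neg (by omega), add_zero]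
      congr 1
      omega
  rw [Finset.sum_congr rfl fun k _ => h k, Finset.sum_add_distrib, Finset.sum_const,
    Fin.sum_univ_eq_sum_range (fun k => if k ∈ Finset.Ico A B then 1 / ((B : ℝ) - A) else 0),
    Finset.sum_ite_mem, Finset.inter_eq_right.2, Finset.sum_const, Nat.card_Ico]
  · have : (B : ℝ) - A ≠ 0 := by
      have : (A : ℝ) < B := by exact_mod_cast hAB
      linarith
    simp [Nat.cast_sub hAB.le, this]
  · intro x hx
    rw [Finset.mem_Ico] at hx
    rw [Finset.mem_range]
    omega

theorem sum_harm_place (p q : ℕ) {a b : ℕ} (hab : a < b) (hb : b ≤ p) :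
    ∑ f ∈ shuffles p (p + q), harm (place f b - place f a - 1) =
      (shuffles p (p + q)).card * (harm (b - a - 1) + harm (p + q) - harm p) := by
  induction q with
  | zero =>
    have h (m : ℕ) (hm : m ≤ p) : place (id : Fin p → Fin p) m = m := by
      rcases m with _ | m
      · exact place_zero _
      · exact place_succ strictMono_id ⟨m, hm⟩
    simp [shuffles_self, h b hb, h a (by omega)]
  | succ q ih =>
    have h1 := sum_shuffles_succ (p := p) (n := p + q)
      fun f => harm (place f b - place f a - 1)
    have h2 : ∀ f ∈ shuffles p (p + q), ∑ k : Fin (p + q + 1),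
        harm (place (fun j => k.succAbove (f j)) b - place (fun j => k.succAbove (f j)) a - 1) =
        (((p + q : ℕ) : ℝ) + 1) * harm (place f b - place f a - 1) + 1 := by
      intro f hf
      rw [mem_shuffles] at hf
      simp only [place_succAbove hf _ hb, place_succAbove hf _ (hab.le.trans hb)]
      exact sum_harm_insert (place_lt hf hab hb) (place_le f b)
    rw [Finset.sum_congr rfl h2, Finset.sum_add_distrib, ← Finset.mul_sum, ih, Finset.sum_const,
      nsmul_eq_mul, mul_one] at h1
    have h3 := card_shuffles_succ p q
    have h4 := harm_succ (p + q)
    have hq : (q : ℝ) + 1 ≠ 0 := by positivity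
    have hpq : (p : ℝ) + q + 1 ≠ 0 := by positivity
    refine mul_left_cancel₀ hq ?_
    rw [← mul_assoc, ← h3]
    push_cast at h1 h4
    rw [← add_assoc, h4]
    have h5 : (p : ℝ) + q + 1 - p = q + 1 := by ring
    rw [h5] at h1
    rw [← h1]
    field_simp
    ring

theorem card_shuffles_mul_factorial (p q : ℕ) :
    (shuffles p (p + q)).card * (p.factorial * q.factorial) = (p + q).factorial := by
  induction q with
  | zero => simp [shuffles_self]
  | succ q ih =>
    have h := card_shuffles_succ p q
    have h' : (p + q + 1) * (shuffles p (p + q)).card =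
        (q + 1) * (shuffles p (p + (q + 1))).card := by exact_mod_cast h
    rw [← add_assoc] at h' ⊢
    rw [Nat.factorial_succ (p + q), ← ih, ← mul_assoc (p + q + 1), h', Nat.factorial_succ]
    ring

theorem card_shuffles_pos (p q : ℕ) : 0 < (shuffles p (p + q)).card := by
  refine Nat.pos_of_ne_zero fun h => ?_
  have := card_shuffles_mul_factorial p q
  rw [h, zero_mul] at this
  exact (Nat.factorial_pos (p + q)).ne this

theorem two_pow_le_card_shuffles {p q : ℕ} (h : q ≤ p) : 2 ^ q ≤ (shuffles p (p + q)).card := by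
  induction q with
  | zero => simp [shuffles_self]
  | succ q ih =>
    have h1 := card_shuffles_succ p q
    have h1 : (p + q + 1) * (shuffles p (p + q)).card =
        (q + 1) * (shuffles p (p + (q + 1))).card := by exact_mod_cast h1
    have h2 := ih (by omega)
    have h3 : (2 * (q + 1)) * (shuffles p (p + q)).card ≤
        (p + q + 1) * (shuffles p (p + q)).card := Nat.mul_le_mul_right _ (by omega)
    refine Nat.le_of_mul_le_mul_left ?_ (Nat.succ_pos q)
    rw [Nat.succ_eq_add_one, ← h1, pow_succ]
    nlinarith

theorem log_card_shuffles_le (p q : ℕ) :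
    Real.log (shuffles p (p + q)).card ≤
      p * (harm (p + q) - harm p) + q * (harm (p + q) - harm q) := by
  induction q with
  | zero => simp [shuffles_self]
  | succ q ih =>
    have hmono : Monotone fun n : ℕ => harm n - Real.log ((n : ℝ) + 1) := by
      refine monotone_nat_of_le_succ fun n => ?_
      have h1 := harm_succ n
      have h2 := Real.log_le_sub_one_of_pos (show 0 < ((n : ℝ) + 1 + 1) / (n + 1) by positivity)
      rw [Real.log_div (by positivity) (by positivity)] at h2
      have h3 : ((n : ℝ) + 1 + 1) / (n + 1) - 1 = 1 / (n + 1) := by field_simp; ring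
      push_cast
      linarith
    have h1 := hmono (show q ≤ p + q by omega)
    have h2 := congrArg Real.log (card_shuffles_succ p q)
    have hM : ((shuffles p (p + q)).card : ℝ) ≠ 0 := by
      exact_mod_cast (card_shuffles_pos p q).ne'
    have hM' : ((shuffles p (p + (q + 1))).card : ℝ) ≠ 0 := by
      exact_mod_cast (card_shuffles_pos p (q + 1)).ne'
    rw [Real.log_mul (by positivity) hM, Real.log_mul (by positivity) hM'] at h2
    have h3 := harm_succ (p + q)
    have h4 := harm_succ q
    rw [add_assoc] at h3
    have h5 : ((p : ℝ) + q + 1) * (1 / (p + q + 1)) = 1 := by field_simp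
    have h6 : ((q : ℝ) + 1) * (1 / (q + 1)) = 1 := by field_simp
    push_cast at *
    rw [h3, h4]
    linear_combination h1 + ih - h2 - h5 + h6
/-! ### Parallel composition -/

/-- The bijection interleaving `τ` and `ρ`, where `f` gives the positions of the first factor. -/
noncomputable def interleave {α β : Type} {p q : ℕ} (τ : α ≃ Fin p) (ρ : β ≃ Fin q)
    (f : {f : Fin p → Fin (p + q) // StrictMono f}) : α ⊕ β ≃ Fin (p + q) :=
  (τ.sumCongr ρ).trans <| finSumEquivOfFinset (s := Finset.univ.image f.1)
    (by rw [Finset.card_image_of_injective _ f.2.injective, Finset.card_univ, Fintype.card_fin])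
    (by
      rw [Finset.card_compl, Finset.card_image_of_injective _ f.2.injective, Finset.card_univ,
        Fintype.card_fin, Fintype.card_fin, Nat.add_sub_cancel_left])

section Parallel

variable {α β : Type} {p q : ℕ}

theorem interleave_inl (τ : α ≃ Fin p) (ρ : β ≃ Fin q)
    (f : {f : Fin p → Fin (p + q) // StrictMono f}) (i : α) :
    interleave τ ρ f (Sum.inl i) = f.1 (τ i) := by
  simp only [interleave, Equiv.trans_apply, Equiv.sumCongr_apply, Sum.map_inl,
    finSumEquivOfFinset_inl]
  rw [← Finset.orderEmbOfFin_unique _ (fun x => Finset.mem_image_of_mem _ (Finset.mem_univ x)) f.2]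

theorem interleave_inr_le (τ : α ≃ Fin p) (ρ : β ≃ Fin q)
    (f : {f : Fin p → Fin (p + q) // StrictMono f}) (i j : β) :
    interleave τ ρ f (Sum.inr i) ≤ interleave τ ρ f (Sum.inr j) ↔ ρ i ≤ ρ j := by
  simp [interleave]

theorem interleave_injective : Function.Injective
    fun x : (α ≃ Fin p) × (β ≃ Fin q) × {f : Fin p → Fin (p + q) // StrictMono f} =>
      interleave x.1 x.2.1 x.2.2 := by
  rintro ⟨τ, ρ, f⟩ ⟨τ', ρ', f'⟩ h
  dsimp only at h
  have hinl (i : α) : f.1 (τ i) = f'.1 (τ' i) := by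
    rw [← interleave_inl τ ρ f, h, interleave_inl]
  obtain rfl : f = f' := by
    refine Subtype.ext ((f.2.range_inj f'.2).1 ?_)
    have h1 : Set.range (f.1 ∘ τ) = Set.range (f'.1 ∘ τ') := congrArg _ (funext hinl)
    rwa [τ.surjective.range_comp, τ'.surjective.range_comp] at h1
  have h1 : ∀ x, τ.sumCongr ρ x = τ'.sumCongr ρ' x := fun x => by
    have := DFunLike.congr_fun h x
    simpa only [interleave, Equiv.trans_apply, EmbeddingLike.apply_eq_iff_eq] using this
  obtain rfl : τ = τ' := Equiv.ext fun i => by simpa using h1 (Sum.inl i)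
  obtain rfl : ρ = ρ' := Equiv.ext fun i => by simpa using h1 (Sum.inr i)
  rfl

theorem parallelComp_swap (r : α → α → Prop) (s : β → β → Prop) (x y : α ⊕ β) :
    parallelComp r s x y ↔ parallelComp s r (Equiv.sumComm α β x) (Equiv.sumComm α β y) := by
  rcases x with x | x <;> rcases y with y | y <;> simp [parallelComp]

variable [Fintype α] [Fintype β]

theorem interleave_bijective (hp : Fintype.card α = p) (hq : Fintype.card β = q) :
    Function.Bijective
      fun x : (α ≃ Fin p) × (β ≃ Fin q) × {f : Fin p → Fin (p + q) // StrictMono f} =>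
        interleave x.1 x.2.1 x.2.2 := by
  refine (Fintype.bijective_iff_injective_and_card _).2 ⟨interleave_injective, ?_⟩
  rw [Fintype.card_prod, Fintype.card_prod,
    Fintype.card_equiv (Fintype.equivFinOfCardEq hp), Fintype.card_equiv (Fintype.equivFinOfCardEq hq),
    Fintype.card_equiv (Fintype.equivFinOfCardEq (by rw [Fintype.card_sum, hp, hq])),
    Fintype.card_sum, hp, hq, Fintype.card_subtype, ← card_shuffles_mul_factorial p q, shuffles]
  ring

theorem interleave_mem_lext {r : α → α → Prop} {s : β → β → Prop} {τ : α ≃ Fin p}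
    {ρ : β ≃ Fin q} {f : {f : Fin p → Fin (p + q) // StrictMono f}} :
    interleave τ ρ f ∈ lext (p + q) (parallelComp r s) ↔ τ ∈ lext p r ∧ ρ ∈ lext q s := by
  simp only [mem_lext]
  constructor
  · intro h
    refine ⟨fun i j hij => ?_, fun i j hij => ?_⟩
    · have := h (Sum.inl i) (Sum.inl j) hij
      rwa [interleave_inl, interleave_inl, f.2.le_iff_le] at this
    · exact (interleave_inr_le τ ρ f i j).1 (h (Sum.inr i) (Sum.inr j) hij)
  · rintro ⟨h1, h2⟩ (i | i) (j | j) hij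
    · rw [interleave_inl, interleave_inl, f.2.le_iff_le]
      exact h1 i j hij
    · exact hij.elim
    · exact hij.elim
    · exact (interleave_inr_le τ ρ f i j).2 (h2 i j hij)

theorem sum_lext_parallel_inl (hp : Fintype.card α = p) (hq : Fintype.card β = q)
    (r : α → α → Prop) (s : β → β → Prop) (G : (α → ℕ) → ℝ) :
    ∑ σ ∈ lext (p + q) (parallelComp r s), G (fun i => σ (Sum.inl i)) =
      (lext q s).card * ∑ τ ∈ lext p r, ∑ f ∈ shuffles p (p + q), G fun i => f (τ i) := by
  have h1 : ∑ σ ∈ lext (p + q) (parallelComp r s), G (fun i => σ (Sum.inl i)) =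
      ∑ σ : α ⊕ β ≃ Fin (p + q), if σ ∈ lext (p + q) (parallelComp r s) then
        G (fun i => σ (Sum.inl i)) else 0 := by
    rw [Finset.sum_ite_mem, Finset.univ_inter]
  have h2 : ∀ τ : α ≃ Fin p, ∑ f ∈ shuffles p (p + q), G (fun i => f (τ i)) =
      ∑ f : {f : Fin p → Fin (p + q) // StrictMono f}, G fun i => f.1 (τ i) := fun τ =>
    Finset.sum_subtype _ (fun f => mem_shuffles) _
  rw [h1, ← (interleave_bijective hp hq).sum_comp, Fintype.sum_prod_type]
  simp only [Fintype.sum_prod_type, interleave_mem_lext, interleave_inl, h2]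
  rw [Finset.mul_sum, ← Finset.univ_inter (lext p r), ← Finset.sum_ite_mem]
  refine Finset.sum_congr rfl fun τ _ => ?_
  by_cases hτ : τ ∈ lext p r
  · simp only [hτ]
    rw [← nsmul_eq_mul, ← Finset.sum_const, ← Finset.univ_inter (lext q s), ← Finset.sum_ite_mem]
    refine Finset.sum_congr rfl fun ρ _ => ?_
    by_cases hρ : ρ ∈ lext q s <;> simp [hρ, hτ]
  · simp [hτ]

theorem lastPred_shuffle (r : α → α → Prop) (τ : α ≃ Fin p) {f : Fin p → Fin (p + q)}
    (hf : StrictMono f) (i : α) :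
    lastPred r (fun j => (f (τ j) : ℕ)) i = place f (lastPred r (fun j => (τ j : ℕ)) i) := by
  apply le_antisymm
  · refine lastPred_le_iff.2 fun j hj hr => ?_
    rw [← place_succ hf]
    exact place_mono f (le_lastPred (pos := fun j => (τ j : ℕ)) hj hr)
  · rcases lastPred_eq_zero_or r (fun j => (τ j : ℕ)) i with ⟨_, h0⟩ | ⟨j, hj, hr, h0⟩
    · simp [h0, place_zero]
    · rw [h0, place_succ hf]
      exact le_lastPred (pos := fun j => (f (τ j) : ℕ)) hj hr

theorem sum_shuffles_cost (hp : Fintype.card α = p) {r : α → α → Prop} {τ : α ≃ Fin p}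
    (hτ : τ ∈ lext p r) :
    ∑ f ∈ shuffles p (p + q), cost r (fun i => (f (τ i) : ℕ)) =
      (shuffles p (p + q)).card *
        (cost r (fun i => (τ i : ℕ)) + p * (harm (p + q) - harm p)) := by
  have h : ∀ f ∈ shuffles p (p + q), cost r (fun i => (f (τ i) : ℕ)) =
      ∑ i, harm (place f (τ i + 1) - place f (lastPred r (fun j => (τ j : ℕ)) i) - 1) := by
    intro f hf
    rw [mem_shuffles] at hf
    refine Finset.sum_congr rfl fun i _ => ?_
    rw [gap, lastPred_shuffle r τ hf, place_succ hf]
  rw [Finset.sum_congr rfl h, Finset.sum_comm]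
  have h' (i : α) := sum_harm_place p q (a := lastPred r (fun j => (τ j : ℕ)) i)
    (b := τ i + 1) (Nat.lt_succ_of_le (lastPred_le_of_mem hτ i)) (τ i).2
  simp only [h']
  rw [← Finset.mul_sum]
  congr 1
  simp only [add_sub_assoc, Finset.sum_add_distrib, Finset.sum_const, Finset.card_univ, hp,
    nsmul_eq_mul]
  rfl

theorem sum_lext_parallel_cost_inl (hp : Fintype.card α = p) (hq : Fintype.card β = q)
    (r : α → α → Prop) (s : β → β → Prop) :
    ∑ σ ∈ lext (p + q) (parallelComp r s), cost r (fun i => (σ (Sum.inl i) : ℕ)) =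
      (shuffles p (p + q)).card * (lext q s).card *
        (totalCost p r + (lext p r).card * (p * (harm (p + q) - harm p))) := by
  rw [sum_lext_parallel_inl hp hq r s (cost r),
    Finset.sum_congr rfl fun τ hτ => sum_shuffles_cost hp hτ, ← Finset.mul_sum,
    Finset.sum_add_distrib, Finset.sum_const, nsmul_eq_mul, totalCost]
  ring

theorem card_lext_parallel (hp : Fintype.card α = p) (hq : Fintype.card β = q)
    (r : α → α → Prop) (s : β → β → Prop) :
    (lext (p + q) (parallelComp r s)).card =
      (shuffles p (p + q)).card * ((lext p r).card * (lext q s).card) := by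
  have := sum_lext_parallel_inl hp hq r s fun _ => 1
  simp only [Finset.sum_const, nsmul_eq_mul, mul_one] at this
  have h : (lext (p + q) (parallelComp r s)).card =
      (lext q s).card * ((lext p r).card * (shuffles p (p + q)).card) := by exact_mod_cast this
  rw [h]
  ring

theorem cost_parallel (r : α → α → Prop) (s : β → β → Prop) (pos : α ⊕ β → ℕ) :
    cost (parallelComp r s) pos =
      cost r (fun i => pos (Sum.inl i)) + cost s (fun j => pos (Sum.inr j)) := by
  rw [cost, Fintype.sum_sum_type]
  congr 1 <;> refine Finset.sum_congr rfl fun i _ => ?_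
  · rw [gap, gap, lastPred_inl (r := r) (by simp [parallelComp]) (by simp [parallelComp])]
  · rw [gap, gap, lastPred_inr (s := s) (by simp [parallelComp]) (by simp [parallelComp])]

theorem totalCost_parallel (hp : Fintype.card α = p) (hq : Fintype.card β = q)
    (r : α → α → Prop) (s : β → β → Prop) :
    totalCost (p + q) (parallelComp r s) = (shuffles p (p + q)).card *
      ((lext q s).card * totalCost p r + (lext p r).card * totalCost q s +
        (lext p r).card * (lext q s).card *
          (p * (harm (p + q) - harm p) + q * (harm (p + q) - harm q))) := by
  have hinr : ∑ σ ∈ lext (p + q) (parallelComp r s), cost s (fun j => (σ (Sum.inr j) : ℕ)) =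
      ∑ σ ∈ lext (q + p) (parallelComp s r), cost s (fun j => (σ (Sum.inl j) : ℕ)) := by
    rw [add_comm q p]
    exact sum_lext_iso (Equiv.sumComm α β) (parallelComp_swap r s) (p + q)
      fun pos => cost s fun j => pos (Sum.inr j)
  have hcard : (shuffles q (q + p)).card = (shuffles p (p + q)).card := by
    refine Nat.eq_of_mul_eq_mul_right
      (Nat.mul_pos (Nat.factorial_pos p) (Nat.factorial_pos q)) ?_
    rw [card_shuffles_mul_factorial, mul_comm p.factorial, card_shuffles_mul_factorial, add_comm]
  simp only [totalCost, cost_parallel, Finset.sum_add_distrib]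
  rw [hinr, sum_lext_parallel_cost_inl hp hq, sum_lext_parallel_cost_inl hq hp, hcard,
    add_comm q p, totalCost, totalCost]
  ring

end Parallel
/-! ### Posets partitioned into four chains -/

theorem sum_cons_words (x : ℝ) (m : ℕ) (a : Fin 4) :
    ∑ w : Fin m → Fin 4, ∏ t : Fin m,
      (if (Fin.cons a w : Fin (m + 1) → Fin 4) t.castSucc =
        (Fin.cons a w : Fin (m + 1) → Fin 4) t.succ then (1 : ℝ) else x) = (1 + 3 * x) ^ m := by
  induction m generalizing a with
  | zero => simp
  | succ m ih =>
    simp only [Fin.cons_succ] at ih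
    rw [← (Fin.consEquiv fun _ : Fin (m + 1) => Fin 4).sum_comp, Fintype.sum_prod_type]
    simp only [Fin.consEquiv_apply, Fin.prod_univ_succ, Fin.castSucc_zero, Fin.cons_zero,
      Fin.cons_succ, ← Fin.succ_castSucc, ← Finset.mul_sum, ih]
    rw [← Finset.sum_mul, pow_succ']
    congr 1
    fin_cases a <;> simp [Fin.sum_univ_four] <;> ring

theorem sum_words (x : ℝ) (m : ℕ) :
    ∑ w : Fin (m + 1) → Fin 4, ∏ t : Fin m,
      (if w t.castSucc = w t.succ then (1 : ℝ) else x) = 4 * (1 + 3 * x) ^ m := by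
  rw [← (Fin.consEquiv fun _ : Fin (m + 1) => Fin 4).sum_comp, Fintype.sum_prod_type]
  simp only [Fin.consEquiv_apply, sum_cons_words]
  simp

section Chains

variable {α : Type} [Fintype α] {r : α → α → Prop} {c : α → Fin 4}

theorem colouring_injOn {n : ℕ} (hc : ∀ x y, c x = c y → r x y ∨ r y x) :
    Set.InjOn (fun (σ : α ≃ Fin n) t => c (σ.symm t)) (lext n r : Set (α ≃ Fin n)) := by
  intro σ hσ τ hτ h
  have hσ := mem_lext.1 (Finset.mem_coe.1 hσ)
  have hτ := mem_lext.1 (Finset.mem_coe.1 hτ)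
  have key : ∀ t, σ.symm t = τ.symm t := by
    intro t
    induction t using WellFoundedLT.induction with
    | ind t ih =>
      by_contra hne
      rcases hc _ _ (congrFun h t) with hr | hr
      · have h1 := hτ _ _ hr
        rw [τ.apply_symm_apply] at h1
        have h2 : τ (σ.symm t) < t :=
          lt_of_le_of_ne h1 fun h => hne (τ.eq_symm_apply.2 h)
        have h3 := ih _ h2
        rw [τ.symm_apply_apply] at h3
        exact h2.ne (σ.symm.injective h3)
      · have h1 := hσ _ _ hr
        rw [σ.apply_symm_apply] at h1
        have h2 : σ (τ.symm t) < t :=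
          lt_of_le_of_ne h1 fun h => hne (σ.eq_symm_apply.2 h).symm
        have h3 := ih _ h2
        rw [σ.symm_apply_apply] at h3
        exact h2.ne (τ.symm.injective h3.symm)
  exact Equiv.symm_bijective.injective (Equiv.ext key)

theorem card_changes_le {m : ℕ}
    (hr : ∀ x y x' y', c x ≠ c y → r x y → c x' = c x → c y' = c y → r x' y')
    {σ : α ≃ Fin (m + 1)} (hσ : σ ∈ lext (m + 1) r) :
    ((Finset.univ.filter fun t : Fin m =>
      ¬ c (σ.symm t.castSucc) = c (σ.symm t.succ)).card : ℝ) ≤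
      cost r (fun i => (σ i : ℕ)) + 16 := by
  set S := Finset.univ.filter fun t : Fin m => ¬ c (σ.symm t.castSucc) = c (σ.symm t.succ) with hS
  have hcard := Finset.card_filter_add_card_filter_not (s := S)
    (fun t : Fin m => r (σ.symm t.castSucc) (σ.symm t.succ))
  have h1 : (S.filter fun t : Fin m => r (σ.symm t.castSucc) (σ.symm t.succ)).card ≤ 16 := by
    refine (Finset.card_le_card_of_injOn (t := (Finset.univ : Finset (Fin 4 × Fin 4)))
      (fun t => (c (σ.symm t.castSucc), c (σ.symm t.succ))) (fun _ _ => Finset.mem_univ _)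
      ?_).trans (by simp)
    intro t ht t' ht' h
    simp only [hS, Finset.mem_coe, Finset.mem_filter, Finset.mem_univ, true_and,
      Prod.mk.injEq] at ht ht' h
    have h2 := mem_lext.1 hσ _ _ (hr _ _ _ _ ht.1 ht.2 h.1.symm rfl)
    have h3 := mem_lext.1 hσ _ _ (hr _ _ _ _ ht.1 ht.2 rfl h.2.symm)
    simp only [Equiv.apply_symm_apply, Fin.le_def, Fin.val_castSucc, Fin.val_succ] at h2 h3
    rcases lt_trichotomy (t : ℕ) t' with hlt | heq | hlt
    · have : t'.castSucc = t.succ := Fin.ext (by simp; omega)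
      rw [this] at h
      exact absurd h.1 ht.1
    · exact Fin.ext heq
    · have : t.castSucc = t'.succ := Fin.ext (by simp; omega)
      rw [this] at h
      exact absurd h.1.symm ht'.1
  have h2 : ((S.filter fun t : Fin m => ¬ r (σ.symm t.castSucc) (σ.symm t.succ)).card : ℝ) ≤
      cost r fun i => (σ i : ℕ) := by
    rw [cost, ← σ.symm.sum_comp, Fin.sum_univ_succ, Finset.card_eq_sum_ones, Nat.cast_sum]
    refine le_add_of_nonneg_of_le (harm_nonneg _) ?_
    refine (Finset.sum_le_sum fun t ht => ?_).trans (Finset.sum_le_sum_of_subset_of_nonneg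
      (Finset.subset_univ _) fun t _ _ => harm_nonneg _)
    rw [Nat.cast_one]
    refine one_le_harm ?_
    rw [Finset.mem_filter] at ht
    have h3 : lastPred r (fun i => (σ i : ℕ)) (σ.symm t.succ) ≤ t := by
      refine lastPred_le_iff.2 fun j hj hjr => ?_
      have h4 := mem_lext.1 hσ _ _ hjr
      have h5 : (σ j : ℕ) ≠ t + 1 := fun h => hj (σ.eq_symm_apply.2 (Fin.ext (by simpa using h)))
      have h6 : (σ j : ℕ) ≠ t := fun h => by
        have hj' : j = σ.symm t.castSucc := σ.eq_symm_apply.2 (Fin.ext (by simpa using h))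
        exact ht.2 (hj' ▸ hjr)
      simp only [Equiv.apply_symm_apply, Fin.le_def, Fin.val_succ] at h4
      omega
    simp only [gap, Equiv.apply_symm_apply, Fin.val_succ]
    omega
  have h3 : (S.card : ℝ) ≤
      16 + ((S.filter fun t : Fin m => ¬ r (σ.symm t.castSucc) (σ.symm t.succ)).card : ℝ) := by
    exact_mod_cast (by omega)
  linarith

theorem log_card_lext_le {m : ℕ} (hc : ∀ x y, c x = c y → r x y ∨ r y x)
    (hr : ∀ x y x' y', c x ≠ c y → r x y → c x' = c x → c y' = c y → r x' y')
    (hne : (lext (m + 1) r).Nonempty) :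
    Real.log (lext (m + 1) r).card ≤
      4 * (totalCost (m + 1) r / (lext (m + 1) r).card) + 64 + Real.log 4 +
        3 * Real.exp (-4) * m := by
  set K : ℝ := ((lext (m + 1) r).card : ℝ) with hK
  have hKpos : 0 < K := Nat.cast_pos.2 hne.card_pos
  set Q : ℝ := totalCost (m + 1) r / K with hQ
  set x : ℝ := Real.exp (-4) with hx
  have hxpos : 0 < x := Real.exp_pos _
  have h1 : ∀ σ ∈ lext (m + 1) r,
      Real.exp (-4 * (Q + 16)) * (1 + 4 * Q - 4 * cost r (fun i => (σ i : ℕ))) ≤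
      ∏ t : Fin m, (if c (σ.symm t.castSucc) = c (σ.symm t.succ) then (1 : ℝ) else x) := by
    intro σ hσ
    have h2 := card_changes_le hr hσ
    rw [Finset.prod_ite, Finset.prod_const_one, one_mul, Finset.prod_const, hx,
      ← Real.exp_nat_mul]
    have h3 := Real.add_one_le_exp (4 * Q - 4 * cost r (fun i => (σ i : ℕ)))
    calc _ ≤ Real.exp (-4 * (Q + 16)) *
          Real.exp (4 * Q - 4 * cost r (fun i => (σ i : ℕ))) := by
          refine mul_le_mul_of_nonneg_left ?_ (Real.exp_pos _).le
          linarith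
      _ ≤ _ := by
          rw [← Real.exp_add]
          refine Real.exp_le_exp.2 ?_
          linarith
  have h2 : K * Real.exp (-4 * (Q + 16)) ≤ 4 * (1 + 3 * x) ^ m := by
    calc K * Real.exp (-4 * (Q + 16)) = ∑ σ ∈ lext (m + 1) r,
          Real.exp (-4 * (Q + 16)) * (1 + 4 * Q - 4 * cost r (fun i => (σ i : ℕ))) := by
          rw [← Finset.mul_sum, Finset.sum_sub_distrib, Finset.sum_const, ← Finset.mul_sum,
            nsmul_eq_mul, ← hK]
          have : ∑ σ ∈ lext (m + 1) r, cost r (fun i => (σ i : ℕ)) = Q * K := by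
            rw [hQ, div_mul_cancel₀ _ hKpos.ne', totalCost]
          rw [this]
          ring
      _ ≤ ∑ σ ∈ lext (m + 1) r, ∏ t : Fin m,
          (if c (σ.symm t.castSucc) = c (σ.symm t.succ) then (1 : ℝ) else x) :=
          Finset.sum_le_sum h1
      _ = ∑ w ∈ (lext (m + 1) r).image fun σ t => c (σ.symm t), ∏ t : Fin m,
          (if w t.castSucc = w t.succ then (1 : ℝ) else x) :=
          (Finset.sum_image (f := fun w : Fin (m + 1) → Fin 4 => ∏ t : Fin m,
            (if w t.castSucc = w t.succ then (1 : ℝ) else x)) (colouring_injOn hc)).symm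
      _ ≤ ∑ w : Fin (m + 1) → Fin 4, ∏ t : Fin m,
          (if w t.castSucc = w t.succ then (1 : ℝ) else x) :=
          Finset.sum_le_sum_of_subset_of_nonneg (Finset.subset_univ _) fun w _ _ =>
            Finset.prod_nonneg fun t _ => by split_ifs <;> positivity
      _ = _ := sum_words x m
  have h3 := Real.log_le_log (by positivity) h2
  rw [Real.log_mul hKpos.ne' (Real.exp_pos _).ne', Real.log_exp,
    Real.log_mul (by norm_num) (by positivity), Real.log_pow] at h3
  have h4 : Real.log (1 + 3 * x) ≤ 3 * x := by
    have := Real.log_le_sub_one_of_pos (show 0 < 1 + 3 * x by positivity)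
    linarith
  have h5 := mul_le_mul_of_nonneg_left h4 (Nat.cast_nonneg (α := ℝ) m)
  linarith

end Chains

/-! ### The posets `N_k` -/

/-- The chain of `N_k` containing a given element. -/
def NCarrier.chain {k : ℕ} : NCarrier k → Fin 4 :=
  Sum.elim (fun _ => 0) (Sum.elim (fun _ => 1) (Sum.elim (fun _ => 2) fun _ => 3))

theorem NRel_or_of_chain_eq {k : ℕ} (x y : NCarrier k)
    (h : NCarrier.chain x = NCarrier.chain y) : NRel k x y ∨ NRel k y x := by
  rcases x with x | x | x | x <;> rcases y with y | y | y | y <;>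
    simp_all [NCarrier.chain, NRel, le_total]

theorem NRel_of_chain_eq {k : ℕ} (x y x' y' : NCarrier k)
    (hxy : NCarrier.chain x ≠ NCarrier.chain y) (h : NRel k x y)
    (hx : NCarrier.chain x' = NCarrier.chain x) (hy : NCarrier.chain y' = NCarrier.chain y) :
    NRel k x' y' := by
  rcases x with x | x | x | x <;> rcases y with y | y | y | y <;>
    first
    | exact absurd rfl hxy
    | exact h.elim
    | (rcases x' with x' | x' | x' | x' <;> rcases y' with y' | y' | y' | y' <;>
        simp_all [NCarrier.chain, NRel])

theorem card_NCarrier (k : ℕ) : Fintype.card (NCarrier k) = k + k + (k + k) := by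
  simp [NCarrier]
  ring

theorem card_lext_chain_pos (k : ℕ) : 0 < (lext k fun i j : Fin k => i ≤ j).card :=
  Finset.card_pos.2 ⟨Equiv.refl _, mem_lext.2 fun _ _ h => h⟩

/-- Reordering the chains of `N_k` as `(A, C)`, `(B, D)`. -/
def NCarrier.regroup (k : ℕ) : NCarrier k ≃ (Fin k ⊕ Fin k) ⊕ (Fin k ⊕ Fin k) where
  toFun
    | Sum.inl i => Sum.inl (Sum.inl i)
    | Sum.inr (Sum.inl i) => Sum.inr (Sum.inl i)
    | Sum.inr (Sum.inr (Sum.inl i)) => Sum.inl (Sum.inr i)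
    | Sum.inr (Sum.inr (Sum.inr i)) => Sum.inr (Sum.inr i)
  invFun
    | Sum.inl (Sum.inl i) => Sum.inl i
    | Sum.inr (Sum.inl i) => Sum.inr (Sum.inl i)
    | Sum.inl (Sum.inr i) => Sum.inr (Sum.inr (Sum.inl i))
    | Sum.inr (Sum.inr i) => Sum.inr (Sum.inr (Sum.inr i))
  left_inv x := by rcases x with x | x | x | x <;> rfl
  right_inv x := by rcases x with (x | x) | (x | x) <;> rfl

theorem two_pow_le_card_lext_NRel (k : ℕ) : 2 ^ k ≤ (lext (k + k + (k + k)) (NRel k)).card := by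
  let le : Fin k → Fin k → Prop := fun i j => i ≤ j
  have hpar : 2 ^ k ≤ (lext (k + k) (parallelComp le le)).card := by
    rw [card_lext_parallel (Fintype.card_fin k) (Fintype.card_fin k)]
    exact (two_pow_le_card_shuffles le_rfl).trans
      (Nat.le_mul_of_pos_right _ (Nat.mul_pos (card_lext_chain_pos k) (card_lext_chain_pos k)))
  have hser : 2 ^ k ≤ (lext (k + k + (k + k))
      (seriesComp (parallelComp le le) (parallelComp le le))).card := by
    rw [card_lext_series (by simp) (by simp)]
    exact hpar.trans (Nat.le_mul_of_pos_right _ ((Nat.two_pow_pos k).trans_le hpar))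
  refine hser.trans (Finset.card_le_card_of_injOn
    (fun σ => (NCarrier.regroup k).trans σ) (fun σ hσ => ?_) fun σ _ τ _ h => ?_)
  · rw [Finset.mem_coe, mem_lext] at *
    intro i j hij
    refine hσ _ _ ?_
    rcases i with i | i | i | i <;> rcases j with j | j | j | j <;>
      first | exact hij | exact True.intro
  · ext x
    have := DFunLike.congr_fun h ((NCarrier.regroup k).symm x)
    simpa [Fin.ext_iff] using this

theorem one_le_cost_NRel {k n : ℕ} (hk : 1 ≤ k) (σ : NCarrier k ≃ Fin n) :
    1 ≤ cost (NRel k) fun i => (σ i : ℕ) := by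
  let a : NCarrier k := Sum.inl ⟨0, hk⟩
  let c : NCarrier k := Sum.inr (Sum.inr (Sum.inl ⟨0, hk⟩))
  have hmin (i : NCarrier k) (hi : ∀ j, NRel k j i → j = i) (h : 1 ≤ (σ i : ℕ)) :
      1 ≤ cost (NRel k) fun i => (σ i : ℕ) := by
    refine le_trans (one_le_harm ?_) (Finset.single_le_sum
      (f := fun i => harm (gap (NRel k) (fun i => (σ i : ℕ)) i - 1))
      (fun _ _ => harm_nonneg _) (Finset.mem_univ i))
    have : lastPred (NRel k) (fun i => (σ i : ℕ)) i ≤ 0 :=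
      lastPred_le_iff.2 fun j hj hr => absurd (hi j hr) hj
    dsimp only [gap]
    omega
  have hne : (σ a : ℕ) ≠ σ c := fun h => by simpa [a, c] using σ.injective (Fin.ext h)
  rcases Nat.eq_zero_or_pos (σ a) with h | h
  · refine hmin c ?_ (by omega)
    rintro (j | j | j | j) hj
    · exact (hj : False).elim
    · exact (hj : False).elim
    · exact congrArg (fun j => Sum.inr (Sum.inr (Sum.inl j)))
        (le_antisymm hj (Fin.le_def.2 (Nat.zero_le _)))
    · exact (hj : False).elim
  · refine hmin a ?_ h
    rintro (j | j | j | j) hj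
    · exact congrArg Sum.inl (le_antisymm hj (Fin.le_def.2 (Nat.zero_le _)))
    all_goals exact (hj : False).elim

/-! ### The induction -/

section LogBound

variable {α β : Type} [Fintype α] [Fintype β] {r : α → α → Prop} {s : β → β → Prop} {c : ℝ}

/-- The bound `QLB ≥ c * log |Δ|`, with denominators cleared. -/
def LogBound (c : ℝ) (r : α → α → Prop) : Prop :=
  0 < (lext (Fintype.card α) r).card ∧
    c * (lext (Fintype.card α) r).card * Real.log (lext (Fintype.card α) r).card ≤
      totalCost (Fintype.card α) r

theorem LogBound.series (hr : LogBound c r) (hs : LogBound c s) :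
    LogBound c (seriesComp r s) := by
  unfold LogBound
  rw [Fintype.card_sum, card_lext_series rfl rfl, totalCost_series rfl rfl]
  obtain ⟨hr0, hr⟩ := hr
  obtain ⟨hs0, hs⟩ := hs
  refine ⟨Nat.mul_pos hr0 hs0, ?_⟩
  have hr0' : (0 : ℝ) < (lext (Fintype.card α) r).card := by exact_mod_cast hr0
  have hs0' : (0 : ℝ) < (lext (Fintype.card β) s).card := by exact_mod_cast hs0
  rw [Nat.cast_mul, Real.log_mul hr0'.ne' hs0'.ne']
  have h1 := mul_le_mul_of_nonneg_left hr hs0'.le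
  have h2 := mul_le_mul_of_nonneg_left hs hr0'.le
  linarith

theorem LogBound.parallel (hc : c ≤ 1) (hr : LogBound c r) (hs : LogBound c s) :
    LogBound c (parallelComp r s) := by
  unfold LogBound
  rw [Fintype.card_sum, card_lext_parallel rfl rfl, totalCost_parallel rfl rfl]
  obtain ⟨hr0, hr⟩ := hr
  obtain ⟨hs0, hs⟩ := hs
  have hM0 := card_shuffles_pos (Fintype.card α) (Fintype.card β)
  refine ⟨Nat.mul_pos hM0 (Nat.mul_pos hr0 hs0), ?_⟩
  have hM := log_card_shuffles_le (Fintype.card α) (Fintype.card β)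
  have hM1 : (1 : ℝ) ≤ (shuffles (Fintype.card α) (Fintype.card α + Fintype.card β)).card := by
    exact_mod_cast hM0
  have hr0' : (0 : ℝ) < (lext (Fintype.card α) r).card := by exact_mod_cast hr0
  have hs0' : (0 : ℝ) < (lext (Fintype.card β) s).card := by exact_mod_cast hs0
  have hM0' : (0 : ℝ) < (shuffles (Fintype.card α) (Fintype.card α + Fintype.card β)).card := by
    exact_mod_cast hM0
  rw [Nat.cast_mul, Nat.cast_mul, Real.log_mul hM0'.ne' (by positivity),
    Real.log_mul hr0'.ne' hs0'.ne']
  have h1 := mul_le_mul_of_nonneg_left hr hs0'.le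
  have h2 := mul_le_mul_of_nonneg_left hs hr0'.le
  have h3 := mul_le_mul_of_nonneg_left
    ((mul_le_of_le_one_left (Real.log_nonneg hM1) hc).trans hM) (mul_pos hr0' hs0').le
  have h4 := mul_le_mul_of_nonneg_left (add_le_add (add_le_add h1 h2) h3) hM0'.le
  linarith

theorem logBound_of_subsingleton [Subsingleton α] (hr : ∀ σ, σ ∈ lext (Fintype.card α) r) :
    LogBound c r := by
  have h : (lext (Fintype.card α) r).card = 1 :=
    Finset.card_eq_one.2 ⟨Fintype.equivFin α, Finset.eq_singleton_iff_unique_mem.2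
      ⟨hr _, fun σ _ => Equiv.ext fun i => by
        have := Fintype.card_le_one_iff_subsingleton.2 ‹Subsingleton α›
        have := (σ i).2
        have := (Fintype.equivFin α i).2
        exact Fin.ext (by omega)⟩⟩
  unfold LogBound
  rw [h, totalCost]
  simp only [Nat.cast_one, Real.log_one, mul_zero]
  exact ⟨one_pos, Finset.sum_nonneg fun σ _ => cost_nonneg r _⟩

theorem logBound_NRel {k : ℕ} (hk : 1 ≤ k) : LogBound (1 / 140) (NRel k) := by
  unfold LogBound
  have h2k := two_pow_le_card_lext_NRel k
  rw [card_NCarrier]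
  obtain ⟨m, hm⟩ : ∃ m, k + k + (k + k) = m + 1 := ⟨k + k + (k + k) - 1, by omega⟩
  rw [hm] at h2k ⊢
  have hpos : 0 < (lext (m + 1) (NRel k)).card := (Nat.two_pow_pos k).trans_le h2k
  refine ⟨hpos, ?_⟩
  have h1 := log_card_lext_le (c := NCarrier.chain) NRel_or_of_chain_eq NRel_of_chain_eq
    (Finset.card_pos.1 hpos)
  set K : ℝ := ((lext (m + 1) (NRel k)).card : ℝ) with hK
  have hKpos : 0 < K := Nat.cast_pos.2 hpos
  have h2 : 1 ≤ totalCost (m + 1) (NRel k) / K := by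
    rw [le_div_iff₀ hKpos, one_mul, hK, Finset.card_eq_sum_ones, Nat.cast_sum, totalCost]
    exact Finset.sum_le_sum fun σ _ => by simpa using one_le_cost_NRel hk σ
  have h3 : k * Real.log 2 ≤ Real.log K := by
    rw [← Real.log_pow]
    refine Real.log_le_log (by positivity) ?_
    rw [hK]
    exact_mod_cast h2k
  have h4 : Real.exp (-4) ≤ 1 / 48 := by
    have h5 := Real.exp_one_gt_d9
    have h6 : Real.exp 4 = Real.exp 1 ^ 4 := by rw [← Real.exp_nat_mul]; norm_num
    rw [Real.exp_neg, ← one_div]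
    refine one_div_le_one_div_of_le (by norm_num) ?_
    rw [h6]
    calc (48 : ℝ) ≤ 2.7 ^ 4 := by norm_num
      _ ≤ _ := pow_le_pow_left₀ (by norm_num) (by linarith) 4
  have h5 : (m : ℝ) ≤ 4 * k := by
    have : m ≤ 4 * k := by omega
    exact_mod_cast this
  have h6 : 3 * Real.exp (-4) * m ≤ k / 4 := by
    have := mul_le_mul h4 h5 (Nat.cast_nonneg m) (by norm_num)
    linarith
  have h7 := Real.log_two_gt_d9
  have h8 : (k : ℝ) * (1 / 2) ≤ k * Real.log 2 :=
    mul_le_mul_of_nonneg_left (by linarith) (Nat.cast_nonneg k)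
  have h9 : Real.log 4 ≤ 2 := by
    have h := Real.log_two_lt_d9
    rw [show (4 : ℝ) = 2 ^ 2 by norm_num, Real.log_pow]
    push_cast
    linarith
  have h10 : 1 / 140 * Real.log K ≤ totalCost (m + 1) (NRel k) / K := by linarith
  rw [le_div_iff₀ hKpos] at h10
  linarith

end LogBound

noncomputable instance ESPTree.fintypeCarrier : (t : ESPTree) → Fintype t.carrier
  | .leaf => inferInstanceAs (Fintype Unit)
  | .nk k _ => inferInstanceAs (Fintype (NCarrier k))
  | .series l r =>
    letI := l.fintypeCarrier
    letI := r.fintypeCarrier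
    inferInstanceAs (Fintype (l.carrier ⊕ r.carrier))
  | .parallel l r =>
    letI := l.fintypeCarrier
    letI := r.fintypeCarrier
    inferInstanceAs (Fintype (l.carrier ⊕ r.carrier))

theorem ESPTree.logBound (t : ESPTree) : LogBound (1 / 140) t.rel := by
  induction t with
  | leaf =>
    exact logBound_of_subsingleton (α := Unit) (r := fun _ _ => True)
      fun σ => mem_lext.2 fun i j _ => le_of_eq rfl
  | nk k hk => exact logBound_NRel hk
  | series l r hl hr => exact hl.series hr
  | parallel l r hl hr => exact hl.parallel (by norm_num) hr

/-- There is a universal `c > 0` such that `QLB(P) ≥ c ln |Δ(P)|`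
for every extended series-parallel poset `P`. -/
theorem stmt_16 : ∃ c : ℝ, 0 < c ∧
    ∀ (α : Type) [Fintype α] (r : α → α → Prop) [IsPartialOrder α r],
      IsExtendedSeriesParallel α r →
      c * Real.log ((linExts α r).card) ≤ QLB α r := by
  refine ⟨1 / 140, by norm_num, fun α _ r _ ⟨t, e, h⟩ => ?_⟩
  obtain ⟨hpos, hbound⟩ := t.logBound
  rw [QLB_eq, linExts_eq_lext, Fintype.card_congr e, card_lext_iso e h, totalCost_iso e h,
    le_div_iff₀ (by exact_mod_cast hpos)]
  linarith
end

section
/- Let z = (z_1, ..., z_n) be uniformly distributed on the simplex { z in R^n : 0 ≤ z_1 ≤ z_2 ≤ ... ≤ z_n ≤ 1 } (with respect to the normalized Lebesgue measure on the simplex). Then for all integers i, d with 1 ≤ i and i + d ≤ n and d ≥ 1, and for all real s with 0 ≤ s ≤ 1, the probability that z_{i+d} − z_i ≤ 1 − s equals sum_{l=d}^{n} binomial(n, l) · s^{n−l} · (1−s)^l. -/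
open MeasureTheory Finset

attribute [local instance] Classical.propDecidable

/-- The set of nondecreasing `n`-tuples with entries in `I`. -/
def orderedTuples (n : ℕ) (I : Set ℝ) : Set (Fin n → ℝ) :=
  {z | Monotone z ∧ ∀ j, z j ∈ I}

theorem measurableSet_orderedTuples (n : ℕ) {I : Set ℝ} (hI : MeasurableSet I) :
    MeasurableSet (orderedTuples n I) := by
  refine (isClosed_monotone.measurableSet (α := Fin n → ℝ)).inter ?_
  show MeasurableSet {z : Fin n → ℝ | ∀ j, z j ∈ I}
  simp only [Set.ofPred_forall]
  exact MeasurableSet.iInter fun j => measurable_pi_apply j hI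

theorem snoc_mem_orderedTuples {n : ℕ} {lo : Set ℝ} {b x : ℝ} {w : Fin n → ℝ} :
    (Fin.snoc w x : Fin (n + 1) → ℝ) ∈ orderedTuples (n + 1) (lo ∩ Set.Iic b) ↔
      x ∈ lo ∩ Set.Iic b ∧ w ∈ orderedTuples n (lo ∩ Set.Iic x) := by
  constructor
  · rintro ⟨hm, h⟩
    refine ⟨by simpa using h (Fin.last n), fun j k hjk => ?_, fun j => ⟨?_, ?_⟩⟩
    · simpa using hm (Fin.castSucc_le_castSucc_iff.2 hjk)
    · simpa using (h j.castSucc).1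
    · have := hm (Fin.le_last j.castSucc)
      rwa [Fin.snoc_castSucc, Fin.snoc_last] at this
  · rintro ⟨hx, hm, h⟩
    refine ⟨fun j k => ?_, fun j => ?_⟩
    · induction k using Fin.lastCases with
      | last =>
        induction j using Fin.lastCases with
        | last => simp
        | cast j => intro _; simpa using (h j).2
      | cast k =>
        induction j using Fin.lastCases with
        | last => intro hk; exact absurd hk (not_le.2 (Fin.castSucc_lt_last k))
        | cast j => intro hjk; simpa using hm (Fin.castSucc_le_castSucc_iff.1 hjk)
    · induction j using Fin.lastCases with
      | last => simpa using hx
      | cast j => simpa using And.intro (h j).1 ((h j).2.trans hx.2)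

theorem lintegral_Ioc_pow_div_factorial (n : ℕ) {a b : ℝ} (hab : a ≤ b) :
    ∫⁻ x in Set.Ioc a b, ENNReal.ofReal ((x - a) ^ n / n.factorial) =
      ENNReal.ofReal ((b - a) ^ (n + 1) / (n + 1).factorial) := by
  rw [← ofReal_integral_eq_lintegral_ofReal, ← intervalIntegral.integral_of_le hab,
    intervalIntegral.integral_div, intervalIntegral.integral_comp_sub_right (fun x => x ^ n),
    integral_pow, Nat.factorial_succ]
  · push_cast
    congr 1
    field_simp
    simp
  · exact (by fun_prop : Continuous fun x : ℝ => (x - a) ^ n / n.factorial).integrableOn_Ioc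
  · filter_upwards [ae_restrict_mem measurableSet_Ioc] with x hx
    have : 0 ≤ x - a := sub_nonneg.2 hx.1.le
    positivity

theorem volume_orderedTuples (n : ℕ) {lo : Set ℝ} (hlo : MeasurableSet lo) {a b : ℝ}
    (hae : lo =ᵐ[volume] Set.Ioi a) (hsub : lo ⊆ Set.Ici a) (hab : a ≤ b) :
    volume (orderedTuples n (lo ∩ Set.Iic b)) =
      ENNReal.ofReal ((b - a) ^ n / n.factorial) := by
  induction n generalizing b with
  | zero =>
    have : orderedTuples 0 (lo ∩ Set.Iic b) = Set.univ :=
      Set.eq_univ_of_forall fun z => ⟨Subsingleton.monotone z, fun j => j.elim0⟩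
    rw [this, volume_pi, Measure.pi_univ]
    simp
  | succ n ih =>
    have hS := measurableSet_orderedTuples (n + 1) (hlo.inter (measurableSet_Iic (a := b)))
    have e := (volume_preserving_piFinSuccAbove (fun _ : Fin (n + 1) => ℝ) (Fin.last n)).symm
    have hsec (x : ℝ) : Prod.mk x ⁻¹' ((MeasurableEquiv.piFinSuccAbove (fun _ : Fin (n + 1) => ℝ)
          (Fin.last n)).symm ⁻¹' orderedTuples (n + 1) (lo ∩ Set.Iic b)) =
        {w | x ∈ lo ∩ Set.Iic b ∧ w ∈ orderedTuples n (lo ∩ Set.Iic x)} := by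
      ext w
      rw [Set.mem_ofPred_eq, ← snoc_mem_orderedTuples]
      simp [MeasurableEquiv.piFinSuccAbove_symm_apply, Fin.insertNthEquiv, Fin.insertNth_last']
    have hint (x : ℝ) : volume {w | x ∈ lo ∩ Set.Iic b ∧ w ∈ orderedTuples n (lo ∩ Set.Iic x)} =
        (lo ∩ Set.Iic b).indicator (fun x => ENNReal.ofReal ((x - a) ^ n / n.factorial)) x := by
      by_cases hx : x ∈ lo ∩ Set.Iic b
      · rw [Set.indicator_of_mem hx, ← ih (hsub hx.1)]
        simp only [hx, true_and, Set.ofPred_mem_eq]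
      · simp [hx]
    rw [← e.measure_preimage hS.nullMeasurableSet, Measure.volume_eq_prod,
      Measure.prod_apply (e.measurable hS)]
    simp_rw [hsec, hint]
    rw [lintegral_indicator (hlo.inter measurableSet_Iic),
      setLIntegral_congr (hae.inter (Filter.EventuallyEq.refl _ (Set.Iic b))),
      Set.Ioi_inter_Iic, lintegral_Ioc_pow_div_factorial n hab]

theorem volume_orderedTuples_Icc (n : ℕ) {a b : ℝ} (hab : a ≤ b) :
    volume (orderedTuples n (Set.Icc a b)) = ENNReal.ofReal ((b - a) ^ n / n.factorial) := by
  rw [← Set.Ici_inter_Iic]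
  exact volume_orderedTuples n measurableSet_Ici Ioi_ae_eq_Ici.symm subset_rfl hab

theorem volume_orderedTuples_Ioc (n : ℕ) {a b : ℝ} (hab : a ≤ b) :
    volume (orderedTuples n (Set.Ioc a b)) = ENNReal.ofReal ((b - a) ^ n / n.factorial) := by
  rw [← Set.Ioi_inter_Iic]
  exact volume_orderedTuples n measurableSet_Ioi (Filter.EventuallyEq.refl _ _)
    Set.Ioi_subset_Ici_self hab

theorem append_mem_orderedTuples {d k : ℕ} {t : ℝ} (ht0 : 0 ≤ t) (ht1 : t ≤ 1)
    {u : Fin d → ℝ} {v : Fin k → ℝ} :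
    Fin.append u v ∈ {z ∈ orderedTuples (d + k) (Set.Icc 0 1) | ∀ j, z j ≤ t ↔ (j : ℕ) < d} ↔
      u ∈ orderedTuples d (Set.Icc 0 t) ∧ v ∈ orderedTuples k (Set.Ioc t 1) := by
  constructor
  · rintro ⟨⟨hm, h⟩, ht⟩
    refine ⟨⟨fun i j hij => ?_, fun j => ⟨?_, ?_⟩⟩, ⟨fun i j hij => ?_, fun j => ⟨?_, ?_⟩⟩⟩
    · simpa using hm (show Fin.castAdd k i ≤ Fin.castAdd k j from hij)
    · simpa using (h (Fin.castAdd k j)).1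
    · simpa using (ht (Fin.castAdd k j)).2 (by simp)
    · simpa using hm (show Fin.natAdd d i ≤ Fin.natAdd d j by simpa using hij)
    · simpa using ht (Fin.natAdd d j)
    · simpa using (h (Fin.natAdd d j)).2
  · rintro ⟨⟨hum, hu⟩, ⟨hvm, hv⟩⟩
    refine ⟨⟨fun i j => ?_, fun j => ?_⟩, fun j => ?_⟩
    · induction i using Fin.addCases with
      | left i =>
        induction j using Fin.addCases with
        | left j => intro hij; simpa using hum (show i ≤ j from hij)
        | right j => intro _; simpa using (hu i).2.trans (hv j).1.le
      | right i =>
        induction j using Fin.addCases with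
        | left j =>
          intro hij
          have : d + (i : ℕ) ≤ j := hij
          omega
        | right j => intro hij; simpa using hvm (show i ≤ j by simpa using hij)
    · induction j using Fin.addCases with
      | left j => simpa using And.intro (hu j).1 ((hu j).2.trans ht1)
      | right j => simpa using And.intro (ht0.trans (hv j).1.le) (hv j).2
    · induction j using Fin.addCases with
      | left j => simpa using (hu j).2
      | right j => simpa using (hv j).1

theorem measurePreserving_finAppend (d k : ℕ) :
    MeasurePreserving (fun p : (Fin d → ℝ) × (Fin k → ℝ) => Fin.append p.1 p.2) := by
  have happ : (fun p : (Fin d → ℝ) × (Fin k → ℝ) => Fin.append p.1 p.2) =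
      MeasurableEquiv.piCongrLeft (fun _ : Fin (d + k) => ℝ) finSumFinEquiv ∘
        (MeasurableEquiv.sumPiEquivProdPi (fun _ : Fin d ⊕ Fin k => ℝ)).symm := by
    funext p j
    obtain ⟨j, rfl⟩ := finSumFinEquiv.surjective j
    simp only [Function.comp_apply, MeasurableEquiv.coe_piCongrLeft,
      Equiv.piCongrLeft_apply_apply]
    cases j <;> simp [MeasurableEquiv.coe_sumPiEquivProdPi_symm]
  rw [happ]
  exact (volume_measurePreserving_piCongrLeft (fun _ : Fin (d + k) => ℝ) finSumFinEquiv).comp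
    (volume_measurePreserving_sumPiEquivProdPi_symm (fun _ : Fin d ⊕ Fin k => ℝ))

theorem measurableSet_orderedTuples_le_iff_lt (n d : ℕ) (t : ℝ) :
    MeasurableSet {z ∈ orderedTuples n (Set.Icc 0 1) | ∀ j, z j ≤ t ↔ (j : ℕ) < d} := by
  refine (measurableSet_orderedTuples _ measurableSet_Icc).inter ?_
  show MeasurableSet {z : Fin n → ℝ | ∀ j, z j ≤ t ↔ (j : ℕ) < d}
  simp only [Set.ofPred_forall]
  exact MeasurableSet.iInter fun j =>
    (measurableSet_le (measurable_pi_apply j) measurable_const).iff (MeasurableSet.const _)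

theorem volume_orderedTuples_le_iff_lt {n d : ℕ} (hd : d ≤ n) {t : ℝ} (ht0 : 0 ≤ t)
    (ht1 : t ≤ 1) :
    volume {z ∈ orderedTuples n (Set.Icc 0 1) | ∀ j, z j ≤ t ↔ (j : ℕ) < d} =
      ENNReal.ofReal (t ^ d / d.factorial * ((1 - t) ^ (n - d) / (n - d).factorial)) := by
  obtain ⟨k, rfl⟩ := Nat.exists_eq_add_of_le hd
  rw [← (measurePreserving_finAppend d k).measure_preimage
    (measurableSet_orderedTuples_le_iff_lt _ _ _).nullMeasurableSet]
  have : (fun p : (Fin d → ℝ) × (Fin k → ℝ) => Fin.append p.1 p.2) ⁻¹'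
      {z ∈ orderedTuples (d + k) (Set.Icc 0 1) | ∀ j, z j ≤ t ↔ (j : ℕ) < d} =
      orderedTuples d (Set.Icc 0 t) ×ˢ orderedTuples k (Set.Ioc t 1) := by
    ext p
    exact append_mem_orderedTuples ht0 ht1
  rw [this, Measure.volume_eq_prod, Measure.prod_prod, volume_orderedTuples_Icc d ht0,
    volume_orderedTuples_Ioc k ht1, ENNReal.ofReal_mul (by positivity), sub_zero,
    Nat.add_sub_cancel_left]

/-- For a nondecreasing tuple, exactly one `l` counts its entries that are at most `t`. -/
theorem exists_forall_le_iff_lt {n : ℕ} {z : Fin n → ℝ} (hz : Monotone z) (t : ℝ) :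
    ∃ l ≤ n, ∀ j, z j ≤ t ↔ (j : ℕ) < l := by
  have hex : ∃ l : ℕ, ∀ j : Fin n, l ≤ j → t < z j := ⟨n, fun j hj => absurd j.2 (not_lt.2 hj)⟩
  refine ⟨Nat.find hex, Nat.find_min' hex fun j hj => absurd j.2 (not_lt.2 hj), fun j => ?_⟩
  constructor
  · intro hj
    by_contra! h
    exact absurd (Nat.find_spec hex j h) (not_lt.2 hj)
  · intro hj
    have := Nat.find_min hex hj
    push Not at this
    obtain ⟨k, hjk, hk⟩ := this
    exact (hz (show j ≤ k from hjk)).trans hk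

theorem volume_orderedTuples_apply_le {n : ℕ} (j : Fin n) {t : ℝ} (ht0 : 0 ≤ t) (ht1 : t ≤ 1) :
    volume {z ∈ orderedTuples n (Set.Icc 0 1) | z j ≤ t} =
      ENNReal.ofReal (∑ l ∈ Finset.Icc ((j : ℕ) + 1) n,
        t ^ l / l.factorial * ((1 - t) ^ (n - l) / (n - l).factorial)) := by
  have hunion : {z ∈ orderedTuples n (Set.Icc 0 1) | z j ≤ t} =
      ⋃ l ∈ Finset.Icc ((j : ℕ) + 1) n,
        {z ∈ orderedTuples n (Set.Icc 0 1) | ∀ j, z j ≤ t ↔ (j : ℕ) < l} := by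
    ext z
    simp only [Set.mem_ofPred_eq, Set.mem_iUnion, Finset.mem_Icc, exists_prop]
    constructor
    · rintro ⟨hz, hj⟩
      obtain ⟨l, hl, h⟩ := exists_forall_le_iff_lt hz.1 t
      exact ⟨l, ⟨(h j).1 hj, hl⟩, hz, h⟩
    · rintro ⟨l, hl, hz, h⟩
      exact ⟨hz, (h j).2 hl.1⟩
  have hdisj : Set.PairwiseDisjoint (Finset.Icc ((j : ℕ) + 1) n : Set ℕ) fun l =>
      {z ∈ orderedTuples n (Set.Icc 0 1) | ∀ j, z j ≤ t ↔ (j : ℕ) < l} := by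
    intro l hl m hm hlm
    refine Set.disjoint_left.2 fun z hz hz' => hlm ?_
    have h (i : Fin n) : (i : ℕ) < l ↔ (i : ℕ) < m := (hz.2 i).symm.trans (hz'.2 i)
    simp only [Finset.coe_Icc, Set.mem_Icc] at hl hm
    by_contra hne
    rcases lt_or_gt_of_ne hne with hlt | hlt
    · exact absurd ((h ⟨l, by omega⟩).2 hlt) (lt_irrefl l)
    · exact absurd ((h ⟨m, by omega⟩).1 hlt) (lt_irrefl m)
  have hs : 0 ≤ 1 - t := sub_nonneg.2 ht1
  rw [hunion, measure_biUnion_finset hdisj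
      fun l _ => measurableSet_orderedTuples_le_iff_lt n l t,
    ENNReal.ofReal_sum_of_nonneg fun l _ => by positivity]
  exact Finset.sum_congr rfl fun l hl =>
    volume_orderedTuples_le_iff_lt (Finset.mem_Icc.1 hl).2 ht0 ht1

/-- The linear part of `rotateGaps`. -/
def rotateGapsLinear (m : ℕ) : (Fin (m + 1) → ℝ) ≃ₗ[ℝ] (Fin (m + 1) → ℝ) where
  toFun z := fun k => (Fin.snoc (Fin.tail z) 0 : Fin (m + 1) → ℝ) k - z 0
  invFun w := fun k => (Fin.cons 0 (Fin.init w) : Fin (m + 1) → ℝ) k - w (Fin.last m)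
  map_add' z w := by
    ext k
    induction k using Fin.lastCases with
    | last => simp; ring
    | cast k => simp [Fin.tail]; ring
  map_smul' c z := by
    ext k
    induction k using Fin.lastCases with
    | last => simp
    | cast k => simp [Fin.tail]; ring
  left_inv z := by
    ext k
    induction k using Fin.cases with
    | zero => simp
    | succ k => simp [Fin.init, Fin.tail]
  right_inv w := by
    ext k
    induction k using Fin.lastCases with
    | last => simp
    | cast k => simp [Fin.init, Fin.tail]

/-- The map `(z_0, …, z_m) ↦ (z_1 - z_0, …, z_m - z_0, 1 - z_0)`, which cyclically permutes the
gaps of a nondecreasing tuple in the unit interval. -/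
def rotateGaps (m : ℕ) (z : Fin (m + 1) → ℝ) : Fin (m + 1) → ℝ :=
  fun k => (Fin.snoc (Fin.tail z) 1 : Fin (m + 1) → ℝ) k - z 0

theorem rotateGaps_eq_add (m : ℕ) (z : Fin (m + 1) → ℝ) :
    rotateGaps m z = rotateGapsLinear m z + Pi.single (Fin.last m) 1 := by
  ext k
  induction k using Fin.lastCases with
  | last => simp [rotateGaps, rotateGapsLinear]; ring
  | cast k => simp [rotateGaps, rotateGapsLinear, (Fin.castSucc_lt_last k).ne]

@[simp]
theorem rotateGaps_last (m : ℕ) (z : Fin (m + 1) → ℝ) :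
    rotateGaps m z (Fin.last m) = 1 - z 0 := by
  simp [rotateGaps]

@[simp]
theorem rotateGaps_castSucc (m : ℕ) (z : Fin (m + 1) → ℝ) (k : Fin m) :
    rotateGaps m z k.castSucc = z k.succ - z 0 := by
  simp [rotateGaps, Fin.tail]

theorem rotateGaps_mem_orderedTuples_iff {m : ℕ} {z : Fin (m + 1) → ℝ} :
    rotateGaps m z ∈ orderedTuples (m + 1) (Set.Icc 0 1) ↔
      z ∈ orderedTuples (m + 1) (Set.Icc 0 1) := by
  constructor
  · rintro ⟨hm, h⟩
    have h0 : 0 ≤ z 0 := by simpa using (h (Fin.last m)).2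
    have h0k (k : Fin m) : z 0 ≤ z k.succ := by simpa using (h k.castSucc).1
    have hk1 (k : Fin m) : z k.succ ≤ 1 := by simpa using hm (Fin.le_last k.castSucc)
    have h01 : z 0 ≤ 1 := by simpa using (h (Fin.last m)).1
    refine ⟨fun j k => ?_, fun j => ?_⟩
    · induction j using Fin.cases with
      | zero =>
        induction k using Fin.cases with
        | zero => simp
        | succ k => intro _; exact h0k k
      | succ j =>
        induction k using Fin.cases with
        | zero => intro hj; exact absurd hj (not_le.2 (Fin.succ_pos j))
        | succ k =>
          intro hjk
          simpa using hm (show j.castSucc ≤ k.castSucc from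
            Fin.castSucc_le_castSucc_iff.2 (Fin.succ_le_succ_iff.1 hjk))
    · induction j using Fin.cases with
      | zero => exact ⟨h0, h01⟩
      | succ j => exact ⟨h0.trans (h0k j), hk1 j⟩
  · rintro ⟨hm, h⟩
    have h0 := h 0
    refine ⟨fun j k => ?_, fun j => ?_⟩
    · induction k using Fin.lastCases with
      | last =>
        induction j using Fin.lastCases with
        | last => simp
        | cast j => intro _; simpa using (h j.succ).2
      | cast k =>
        induction j using Fin.lastCases with
        | last => intro hk; exact absurd hk (not_le.2 (Fin.castSucc_lt_last k))
        | cast j =>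
          intro hjk
          simpa using hm (Fin.succ_le_succ_iff.2 (Fin.castSucc_le_castSucc_iff.1 hjk))
    · induction j using Fin.lastCases with
      | last => simpa using And.intro h0.2 h0.1
      | cast j =>
        rw [rotateGaps_castSucc]
        exact ⟨sub_nonneg.2 (hm (Fin.zero_le _)), by linarith [(h j.succ).2, h0.1]⟩

theorem volume_orderedTuples_unit (n : ℕ) :
    volume (orderedTuples n (Set.Icc 0 1)) = ENNReal.ofReal (1 / n.factorial) := by
  simpa using volume_orderedTuples_Icc n zero_le_one

theorem volume_rotateGaps_preimage (m : ℕ) (A : Set (Fin (m + 1) → ℝ)) :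
    volume (rotateGaps m ⁻¹' A) = volume A := by
  obtain ⟨c, hc⟩ : ∃ c : ENNReal, ∀ B : Set (Fin (m + 1) → ℝ),
      volume (rotateGaps m ⁻¹' B) = c * volume B := by
    refine ⟨ENNReal.ofReal
      |LinearMap.det ((rotateGapsLinear m).symm : (Fin (m + 1) → ℝ) →ₗ[ℝ] (Fin (m + 1) → ℝ))|,
      fun B => ?_⟩
    have : rotateGaps m ⁻¹' B =
        rotateGapsLinear m ⁻¹' ((fun w => w + Pi.single (Fin.last m) 1) ⁻¹' B) := by
      ext z
      simp only [Set.mem_preimage, rotateGaps_eq_add]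
    rw [this, Measure.addHaar_preimage_linearEquiv, measure_preimage_add_right]
  have hS : rotateGaps m ⁻¹' orderedTuples (m + 1) (Set.Icc 0 1) =
      orderedTuples (m + 1) (Set.Icc 0 1) :=
    Set.ext fun z => rotateGaps_mem_orderedTuples_iff
  have h := hc (orderedTuples (m + 1) (Set.Icc 0 1))
  rw [hS, volume_orderedTuples_unit] at h
  have hc1 : c = 1 := by
    refine (ENNReal.mul_left_inj ?_ ENNReal.ofReal_ne_top).1 (h.symm.trans (one_mul _).symm)
    exact (ENNReal.ofReal_pos.2 (by positivity)).ne'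
  rw [hc, hc1, one_mul]

theorem volume_orderedTuples_sub_le {n : ℕ} (i e : ℕ) (h : i + (e + 1) < n) (t : ℝ) :
    volume {z ∈ orderedTuples n (Set.Icc 0 1) | z ⟨i + (e + 1), h⟩ - z ⟨i, by omega⟩ ≤ t} =
      volume {z ∈ orderedTuples n (Set.Icc 0 1) | z ⟨e, by omega⟩ ≤ t} := by
  obtain ⟨m, rfl⟩ := Nat.exists_eq_add_of_lt (Nat.zero_lt_of_lt h)
  revert h
  rw [Nat.zero_add]
  intro h
  have hrot (k : ℕ) (hk : k < m) (z : Fin (m + 1) → ℝ) :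
      rotateGaps m z ⟨k, by omega⟩ = z ⟨k + 1, by omega⟩ - z 0 :=
    rotateGaps_castSucc m z ⟨k, hk⟩
  induction i with
  | zero =>
    rw [← volume_rotateGaps_preimage m {z ∈ orderedTuples (m + 1) (Set.Icc 0 1) |
      z ⟨e, by omega⟩ ≤ t}]
    congr 1
    ext z
    simp only [Set.mem_preimage, Set.mem_ofPred_eq, rotateGaps_mem_orderedTuples_iff]
    rw [hrot e (by omega)]
    simp
  | succ i ih =>
    rw [← ih (by omega) hrot, ← volume_rotateGaps_preimage m {z ∈ orderedTuples (m + 1) (Set.Icc 0 1) |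
      z ⟨i + (e + 1), by omega⟩ - z ⟨i, by omega⟩ ≤ t}]
    congr 1
    ext z
    simp only [Set.mem_preimage, Set.mem_ofPred_eq, rotateGaps_mem_orderedTuples_iff]
    rw [hrot (i + (e + 1)) (by omega), hrot i (by omega), sub_sub_sub_cancel_right]
    simp only [show i + 1 + (e + 1) = i + (e + 1) + 1 by omega]

/-- If `z` is uniform on the simplex `0 ≤ z_1 ≤ ⋯ ≤ z_n ≤ 1`, then for
`1 ≤ i`, `1 ≤ d`, `i + d ≤ n` and `0 ≤ s ≤ 1`,
`Pr[z_{i+d} − z_i ≤ 1 − s] = ∑_{l=d}^{n} binom(n,l) s^{n−l} (1−s)^l`. -/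
theorem stmt_19 (n i d : ℕ) (hi : 1 ≤ i) (hd : 1 ≤ d) (hn : i + d ≤ n)
    (s : ℝ) (hs0 : 0 ≤ s) (hs1 : s ≤ 1) :
    ((MeasureTheory.volume
        {z : Fin n → ℝ | Monotone z ∧ ∀ j : Fin n, z j ∈ Set.Icc (0 : ℝ) 1})⁻¹ •
      MeasureTheory.volume.restrict
        {z : Fin n → ℝ | Monotone z ∧ ∀ j : Fin n, z j ∈ Set.Icc (0 : ℝ) 1})
      {z : Fin n → ℝ | z ⟨i + d - 1, by omega⟩ - z ⟨i - 1, by omega⟩ ≤ 1 - s} =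
      ENNReal.ofReal
        (∑ l ∈ Finset.Icc d n, (n.choose l : ℝ) * s ^ (n - l) * (1 - s) ^ l) := by
  obtain ⟨i, rfl⟩ := Nat.exists_eq_add_of_le' hi
  obtain ⟨e, rfl⟩ := Nat.exists_eq_add_of_le' hd
  have ht : 0 ≤ 1 - s := sub_nonneg.2 hs1
  have hmeas : MeasurableSet
      {z : Fin n → ℝ | z ⟨i + 1 + (e + 1) - 1, by omega⟩ - z ⟨i + 1 - 1, by omega⟩ ≤ 1 - s} :=
    measurableSet_le (by fun_prop) measurable_const
  have hset : {z : Fin n → ℝ | z ⟨i + 1 + (e + 1) - 1, by omega⟩ - z ⟨i + 1 - 1, by omega⟩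
        ≤ 1 - s} ∩ orderedTuples n (Set.Icc 0 1) =
      {z ∈ orderedTuples n (Set.Icc 0 1) |
        z ⟨i + (e + 1), by omega⟩ - z ⟨i, by omega⟩ ≤ 1 - s} := by
    ext z
    simp only [Set.mem_inter_iff, Set.mem_ofPred_eq, Nat.add_sub_cancel,
      show i + 1 + (e + 1) - 1 = i + (e + 1) by omega]
    exact and_comm
  change ((volume (orderedTuples n (Set.Icc 0 1)))⁻¹ •
    volume.restrict (orderedTuples n (Set.Icc 0 1))) _ = _
  rw [Measure.smul_apply, Measure.restrict_apply hmeas, hset, smul_eq_mul,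
    volume_orderedTuples_sub_le, volume_orderedTuples_apply_le _ ht (by linarith),
    volume_orderedTuples_unit, ← ENNReal.ofReal_inv_of_pos (by positivity),
    ← ENNReal.ofReal_mul (by positivity), Finset.mul_sum]
  congr 1
  refine Finset.sum_congr rfl fun l hl => ?_
  rw [Nat.cast_choose ℝ (Finset.mem_Icc.1 hl).2, sub_sub_cancel]
  field_simp
end
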